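/- arXiv:2403.08623 — 2 statements merged into one kernel-verified Lean document; each statement's English description precedes it below -/
import Mathlib

section
/- Let m ≥ 2, let Θ ⊆ ℝ² be a realization of the generalized theta graph Θ_m with endpoints p, q, and let P = Θ ∪ δ₁([0,1]) ∪ ⋯ ∪ δ_r([0,1]) be a pulsar realization obtained from Θ by attaching r ≥ 1 rays. Then there exists n ≥ 1 such that for any basepoints x of UConf_3(P) and y of UConf_3(Θ), the fundamental group π₁(UConf_3(P), x) is isomorphic to the free product π₁(UConf_3(Θ), y) ∗ FreeGroup (Fin n). -/
/-- The relation identifying two injective tuples of points that differ by a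
permutation of the coordinates. -/
def permRel (n : ℕ) (X : Type*) (f g : {f : Fin n → X // Function.Injective f}) : Prop :=
  ∃ σ : Equiv.Perm (Fin n), (f : Fin n → X) ∘ σ = (g : Fin n → X)

/-- The unordered configuration space of `n` points on `X`. -/
def UConf (n : ℕ) (X : Type*) [TopologicalSpace X] : Type _ :=
  Quot (permRel n X)

instance (n : ℕ) (X : Type*) [TopologicalSpace X] : TopologicalSpace (UConf n X) :=
  inferInstanceAs (TopologicalSpace (Quot (permRel n X)))

section Proof

open Set Topology unitInterval

section PathCocycle

variable {Y H : Type*} [TopologicalSpace Y] [Group H]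

/-- `κ` is (anti-)multiplicative and homotopy invariant on the paths lying in `V`. -/
structure IsCocycleOn (κ : C(I, Y) → H) (V : Set Y) : Prop where
  trans : ∀ {x y z : Y} (γ : Path x y) (γ' : Path y z), range γ ⊆ V → range γ' ⊆ V →
    κ (γ.trans γ') = κ γ' * κ γ
  homotopic : ∀ {x y : Y} (γ γ' : Path x y) (F : γ.Homotopy γ'), range F ⊆ V → κ γ = κ γ'

/-- The image under `φ` of the straight segment from `a` to `b`. -/
def imageSegment {E : Type*} [AddCommGroup E] [Module ℝ E] [TopologicalSpace E]
    [IsTopologicalAddGroup E] [ContinuousSMul ℝ E] (φ : C(E, Y)) (a b : E) : Path (φ a) (φ b) :=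
  (Path.segment a b).map φ.continuous

section Convex

variable {E : Type*} [AddCommGroup E] [Module ℝ E] [TopologicalSpace E]
  [IsTopologicalAddGroup E] [ContinuousSMul ℝ E]

theorem range_segment_subset {D : Set E} (hD : Convex ℝ D) {a b : E} (ha : a ∈ D) (hb : b ∈ D) :
    range (Path.segment a b) ⊆ D := by
  rintro _ ⟨t, rfl⟩
  rw [Path.segment_apply]
  exact hD.lineMap_mem ha hb t.2

theorem range_imageSegment_subset {D : Set E} (hD : Convex ℝ D) {a b : E} (ha : a ∈ D)
    (hb : b ∈ D) {φ : C(E, Y)} {V : Set Y} (hV : φ '' D ⊆ V) : range (imageSegment φ a b) ⊆ V := by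
  rintro _ ⟨t, rfl⟩
  exact hV ⟨_, range_segment_subset hD ha hb ⟨t, rfl⟩, rfl⟩

theorem IsCocycleOn.eq_of_convex {κ : C(I, Y) → H} {V : Set Y} (hκ : IsCocycleOn κ V) {D : Set E}
    (hD : Convex ℝ D) (φ : C(E, Y)) (hV : φ '' D ⊆ V) {a b : E} (η η' : Path a b)
    (hη : range η ⊆ D) (hη' : range η' ⊆ D) :
    κ (η.map φ.continuous) = κ (η'.map φ.continuous) := by
  let F : η.Homotopy η' :=
    { toFun := fun x => AffineMap.lineMap (η x.2) (η' x.2) (x.1 : ℝ)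
      continuous_toFun := by
        simp only [AffineMap.lineMap_apply_module]
        fun_prop
      map_zero_left := by simp
      map_one_left := by simp
      prop' := by
        rintro t x (rfl | rfl) <;> simp }
  refine hκ.homotopic _ _ (F.map φ) ?_
  rintro _ ⟨x, rfl⟩
  exact hV ⟨_, hD.lineMap_mem (hη ⟨x.2, rfl⟩) (hη' ⟨x.2, rfl⟩) x.1.2, rfl⟩

theorem IsCocycleOn.imageSegment_trans {κ : C(I, Y) → H} {V : Set Y} (hκ : IsCocycleOn κ V)
    {D : Set E} (hD : Convex ℝ D) (φ : C(E, Y)) (hV : φ '' D ⊆ V) {a b c : E} (ha : a ∈ D)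
    (hb : b ∈ D) (hc : c ∈ D) :
    κ (imageSegment φ a c) = κ (imageSegment φ b c) * κ (imageSegment φ a b) := by
  rw [← hκ.trans _ _ (range_imageSegment_subset hD ha hb hV)
    (range_imageSegment_subset hD hb hc hV)]
  have := hκ.eq_of_convex hD φ hV (Path.segment a c)
    ((Path.segment a b).trans (Path.segment b c)) (range_segment_subset hD ha hc) (by
      rw [Path.trans_range]
      exact union_subset (range_segment_subset hD ha hb) (range_segment_subset hD hb hc))
  rw [Path.map_trans] at this
  exact this

end Convex

theorem IsCocycleOn.refl {κ : C(I, Y) → H} {V : Set Y} (hκ : IsCocycleOn κ V) {x : Y}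
    (hx : x ∈ V) : κ (Path.refl x) = 1 := by
  have h := hκ.trans (Path.refl x) (Path.refl x) (by simpa using hx) (by simpa using hx)
  rw [Path.refl_trans_refl] at h
  simpa using h

theorem IsCocycleOn.const {κ : C(I, Y) → H} {V : Set Y} (hκ : IsCocycleOn κ V) {x : Y}
    (hx : x ∈ V) {γ : C(I, Y)} (h : ∀ t, γ t = x) : κ γ = 1 := by
  rw [← hκ.refl hx]
  congr 1
  ext t
  simp [h]

/-- `g` is a primitive of `κ` along `φ` on `[a, b]`, with respect to the cover `𝒰`. -/
def IsPrimitive {ι : Type*} (𝒰 : ι → Set Y) (κ : C(I, Y) → H) (φ : C(ℝ, Y)) (g : ℝ → H)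
    (a b : ℝ) : Prop :=
  ∀ s t, a ≤ s → s ≤ t → t ≤ b → ∀ i, φ '' Icc s t ⊆ 𝒰 i → g t = κ (imageSegment φ s t) * g s

variable {ι : Type*} {𝒰 : ι → Set Y} {κ : C(I, Y) → H}

theorem IsPrimitive.glue (hκ : ∀ i, IsCocycleOn κ (𝒰 i)) {φ : C(ℝ, Y)} {g : ℝ → H}
    {a b c : ℝ} (h₁ : IsPrimitive 𝒰 κ φ g a b) (h₂ : IsPrimitive 𝒰 κ φ g b c) :
    IsPrimitive 𝒰 κ φ g a c := by
  intro s t has hst htc i hi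
  rcases le_total t b with htb | htb
  · exact h₁ s t has hst htb i hi
  rcases le_total b s with hbs | hbs
  · exact h₂ s t hbs hst htc i hi
  rw [h₂ b t le_rfl htb htc i ((image_mono (Icc_subset_Icc hbs le_rfl)).trans hi),
    h₁ s b has hbs le_rfl i ((image_mono (Icc_subset_Icc le_rfl htb)).trans hi), ← mul_assoc,
    (hκ i).imageSegment_trans (convex_Icc s t) φ hi (left_mem_Icc.2 hst) ⟨hbs, htb⟩
      (right_mem_Icc.2 hst)]

theorem IsPrimitive.congr {φ : C(ℝ, Y)} {g g' : ℝ → H} {a b : ℝ} (h : IsPrimitive 𝒰 κ φ g a b)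
    (hg : EqOn g' g (Icc a b)) : IsPrimitive 𝒰 κ φ g' a b := by
  intro s t has hst htb i hi
  rw [hg ⟨has, hst.trans htb⟩, hg ⟨has.trans hst, htb⟩]
  exact h s t has hst htb i hi

theorem isPrimitive_of_subset (hκ : ∀ i, IsCocycleOn κ (𝒰 i)) {φ : C(ℝ, Y)} {a b : ℝ} {j : ι}
    (hj : φ '' Icc a b ⊆ 𝒰 j) (c : H) :
    IsPrimitive 𝒰 κ φ (fun t => κ (imageSegment φ a t) * c) a b := by
  intro s t has hst htb i hi
  have hab := has.trans (hst.trans htb)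
  simp only
  rw [← mul_assoc, (hκ j).imageSegment_trans (convex_Icc a b) φ hj (left_mem_Icc.2 hab)
    ⟨has, hst.trans htb⟩ ⟨has.trans hst, htb⟩]

theorem IsPrimitive.mul_right {φ : C(ℝ, Y)} {g : ℝ → H} {a b : ℝ} (h : IsPrimitive 𝒰 κ φ g a b)
    (c : H) : IsPrimitive 𝒰 κ φ (fun t => g t * c) a b := by
  intro s t has hst htb i hi
  simp only
  rw [h s t has hst htb i hi, mul_assoc]

theorem exists_lebesgue_number {E : Type*} [PseudoMetricSpace E] {K : Set E} (hK : IsCompact K)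
    (ho : ∀ i, IsOpen (𝒰 i)) (hc : ∀ y, ∃ i, y ∈ 𝒰 i) (φ : C(E, Y)) :
    ∃ δ > 0, ∀ x ∈ K, ∃ i, φ '' Metric.ball x δ ⊆ 𝒰 i := by
  obtain ⟨δ, hδ, h⟩ := lebesgue_number_lemma_of_metric (c := fun i => φ ⁻¹' 𝒰 i) hK
    (fun i => (ho i).preimage φ.continuous) (fun x _ => mem_iUnion.2 (hc (φ x)))
  exact ⟨δ, hδ, fun x hx => (h x hx).imp fun i hi => image_subset_iff.2 hi⟩

theorem exists_isPrimitive (ho : ∀ i, IsOpen (𝒰 i)) (hc : ∀ y, ∃ i, y ∈ 𝒰 i)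
    (hκ : ∀ i, IsCocycleOn κ (𝒰 i)) (φ : C(ℝ, Y)) :
    ∃ g, IsPrimitive 𝒰 κ φ g 0 1 ∧ g 0 = 1 := by
  obtain ⟨δ, hδ, h⟩ := exists_lebesgue_number (isCompact_Icc (a := (0 : ℝ)) (b := 1)) ho hc φ
  obtain ⟨N, hN⟩ := exists_nat_one_div_lt hδ
  have hN0 : (0 : ℝ) < N + 1 := by positivity
  have key : ∀ k : ℕ, k ≤ N + 1 → ∃ g, IsPrimitive 𝒰 κ φ g 0 (k / (N + 1)) ∧ g 0 = 1 := by
    intro k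
    induction k with
    | zero =>
      intro _
      obtain ⟨i, hi⟩ := h 0 (by simp)
      have hi' : φ '' Icc 0 0 ⊆ 𝒰 i := by
        refine (image_mono ?_).trans hi
        simpa using hδ
      refine ⟨fun t => κ (imageSegment φ 0 t) * 1, ?_, ?_⟩
      · simpa using isPrimitive_of_subset hκ hi' (1 : H)
      · simp only [mul_one]
        refine (hκ i).const (x := φ 0) (hi' ⟨0, by simp, rfl⟩) fun t => ?_
        simp [imageSegment]
    | succ k ih =>
      intro hk
      obtain ⟨g, hg, hg0⟩ := ih (by omega)
      have hk' : (k : ℝ) / (N + 1) ∈ Icc (0 : ℝ) 1 := by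
        refine ⟨by positivity, (div_le_one hN0).2 ?_⟩
        exact_mod_cast (by omega : k ≤ N + 1)
      obtain ⟨i, hi⟩ := h _ hk'
      have hi' : φ '' Icc ((k : ℝ) / (N + 1)) (((k + 1 : ℕ) : ℝ) / (N + 1)) ⊆ 𝒰 i := by
        refine (image_mono ?_).trans hi
        intro x hx
        rw [Metric.mem_ball, Real.dist_eq, abs_of_nonneg (by linarith [hx.1])]
        have := hx.2
        push_cast at this
        rw [add_div] at this
        linarith
      have hstart : κ (imageSegment φ ((k : ℝ) / (N + 1)) ((k : ℝ) / (N + 1))) = 1 := by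
        refine (hκ i).const (x := φ ((k : ℝ) / (N + 1))) (hi ⟨_, Metric.mem_ball_self hδ, rfl⟩)
          fun t => ?_
        simp [imageSegment]
      refine ⟨fun t => if t ≤ (k : ℝ) / (N + 1) then g t else
        κ (imageSegment φ ((k : ℝ) / (N + 1)) t) * g ((k : ℝ) / (N + 1)), ?_, ?_⟩
      · refine IsPrimitive.glue hκ (b := (k : ℝ) / (N + 1)) (hg.congr fun t ht => if_pos ht.2)
          ((isPrimitive_of_subset hκ hi' (g ((k : ℝ) / (N + 1)))).congr fun t ht => ?_)
        rcases ht.1.eq_or_lt with rfl | hlt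
        · simp [hstart]
        · exact if_neg hlt.not_ge
      · simp only [if_pos hk'.1, hg0]
  obtain ⟨g, hg, hg0⟩ := key (N + 1) le_rfl
  refine ⟨g, ?_, hg0⟩
  convert hg using 1
  push_cast
  rw [div_self hN0.ne']

/-- Restriction of a map on the plane to a horizontal line. -/
def horizontal (Φ : C(ℝ × ℝ, Y)) (s : ℝ) : C(ℝ, Y) := ⟨fun t => Φ (t, s), by fun_prop⟩

theorem IsPrimitive.transport (hκ : ∀ i, IsCocycleOn κ (𝒰 i)) (Φ : C(ℝ × ℝ, Y))
    {δ : ℝ} (hδ : 0 < δ)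
    (h : ∀ x ∈ Icc (0 : ℝ) 1 ×ˢ Icc (0 : ℝ) 1, ∃ i, Φ '' Metric.ball x δ ⊆ 𝒰 i)
    {s s' : ℝ} (hs : s ∈ Icc (0 : ℝ) 1) (hss' : |s' - s| < δ) {g g' : ℝ → H}
    (hg : IsPrimitive 𝒰 κ (horizontal Φ s) g 0 1) (hg' : IsPrimitive 𝒰 κ (horizontal Φ s') g' 0 1)
    (h0 : g' 0 = κ (imageSegment Φ (0, s) (0, s')) * g 0) :
    g' 1 = κ (imageSegment Φ (1, s) (1, s')) * g 1 := by
  obtain ⟨N, hN⟩ := exists_nat_one_div_lt hδ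
  have hN0 : (0 : ℝ) < N + 1 := by positivity
  have key : ∀ k : ℕ, k ≤ N + 1 → g' (k / (N + 1)) =
      κ (imageSegment Φ ((k / (N + 1) : ℝ), s) ((k / (N + 1) : ℝ), s')) * g (k / (N + 1)) := by
    intro k
    induction k with
    | zero =>
      intro _
      have h00 : ((0 : ℕ) : ℝ) / (N + 1) = 0 := by simp
      rwa [h00]
    | succ k ih =>
      intro hk
      have ih := ih (by omega)
      set a : ℝ := k / (N + 1) with ha
      set b : ℝ := (k + 1 : ℕ) / (N + 1) with hb
      have hab : b = a + 1 / (N + 1) := by rw [hb, ha]; push_cast; ring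
      have hab' : a ≤ b := by rw [hab]; linarith [one_div_pos.2 hN0]
      have ha0 : 0 ≤ a := by positivity
      have hb1 : b ≤ 1 := (div_le_one hN0).2 (by exact_mod_cast hk)
      obtain ⟨i, hi⟩ := h (a, s) ⟨⟨ha0, hab'.trans hb1⟩, hs⟩
      have hball : ∀ x u, a ≤ x → x ≤ b → |u - s| < δ → (x, u) ∈ Metric.ball (a, s) δ := by
        intro x u hx hx' hu
        rw [← ball_prod_same, mem_prod, Metric.mem_ball, Metric.mem_ball, Real.dist_eq,
          Real.dist_eq]
        refine ⟨?_, hu⟩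
        rw [abs_of_nonneg (by linarith)]
        linarith
      have hcv := convex_ball (a, s) δ
      have hh : ∀ u, |u - s| < δ → horizontal Φ u '' Icc a b ⊆ 𝒰 i := by
        rintro u hu _ ⟨x, hx, rfl⟩
        exact hi ⟨_, hball x u hx.1 hx.2 hu, rfl⟩
      have hseg : ∀ u, κ (imageSegment (horizontal Φ u) a b) =
          κ (imageSegment Φ (a, u) (b, u)) := by
        intro u
        congr 1
        ext t
        change Φ (AffineMap.lineMap a b (t : ℝ), u) = Φ (AffineMap.lineMap (a, u) (b, u) (t : ℝ))
        simp [AffineMap.lineMap_apply]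
      have hss : |s - s| < δ := by simpa using hδ
      rw [hg' a b ha0 hab' hb1 i (hh s' hss'), hg a b ha0 hab' hb1 i (hh s hss), ih, hseg, hseg,
        ← mul_assoc, ← mul_assoc,
        ← (hκ i).imageSegment_trans hcv Φ hi (hball a s le_rfl hab' hss)
          (hball a s' le_rfl hab' hss') (hball b s' hab' le_rfl hss'),
        ← (hκ i).imageSegment_trans hcv Φ hi (hball a s le_rfl hab' hss)
          (hball b s hab' le_rfl hss) (hball b s' hab' le_rfl hss')]
  have := key (N + 1) le_rfl
  have h1 : ((N + 1 : ℕ) : ℝ) / (N + 1) = 1 := by push_cast; exact div_self hN0.ne'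
  rwa [h1] at this

theorem IsPrimitive.eq_of_vertical_const (ho : ∀ i, IsOpen (𝒰 i)) (hc : ∀ y, ∃ i, y ∈ 𝒰 i)
    (hκ : ∀ i, IsCocycleOn κ (𝒰 i)) (Φ : C(ℝ × ℝ, Y)) {x y : Y} (hx : ∀ s, Φ (0, s) = x)
    (hy : ∀ s, Φ (1, s) = y) {g g' : ℝ → H} (hg : IsPrimitive 𝒰 κ (horizontal Φ 0) g 0 1)
    (hg' : IsPrimitive 𝒰 κ (horizontal Φ 1) g' 0 1) (hg0 : g 0 = 1) (hg0' : g' 0 = 1) :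
    g 1 = g' 1 := by
  obtain ⟨δ, hδ, h⟩ := exists_lebesgue_number
    ((isCompact_Icc (a := (0 : ℝ)) (b := 1)).prod (isCompact_Icc (a := (0 : ℝ)) (b := 1))) ho hc Φ
  obtain ⟨N, hN⟩ := exists_nat_one_div_lt hδ
  have hN0 : (0 : ℝ) < N + 1 := by positivity
  have hconst : ∀ c z, (∀ s, Φ (c, s) = z) → ∀ s s', κ (imageSegment Φ (c, s) (c, s')) = 1 := by
    intro c z hz s s'
    obtain ⟨i, hi⟩ := hc z
    refine (hκ i).const hi fun t => ?_
    simp [imageSegment, Path.segment_apply, AffineMap.lineMap_apply, hz]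
  have step : ∀ s ∈ Icc (0 : ℝ) 1, ∀ s', |s' - s| < δ → ∀ g g' : ℝ → H,
      IsPrimitive 𝒰 κ (horizontal Φ s) g 0 1 → IsPrimitive 𝒰 κ (horizontal Φ s') g' 0 1 →
      g 0 = 1 → g' 0 = 1 → g' 1 = g 1 := by
    intro s hs s' hs' g g' hg hg' h0 h0'
    have := IsPrimitive.transport hκ Φ hδ h hs hs' hg hg' (by rw [hconst 0 x hx, h0, h0', one_mul])
    rwa [hconst 1 y hy, one_mul] at this
  have key : ∀ k : ℕ, k ≤ N + 1 → ∀ g', IsPrimitive 𝒰 κ (horizontal Φ (k / (N + 1))) g' 0 1 →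
      g' 0 = 1 → g' 1 = g 1 := by
    intro k
    induction k with
    | zero =>
      intro _ g' hg' h0'
      exact step 0 (by simp) 0 (by simpa using hδ) g g' hg (by simpa using hg') hg0 h0'
    | succ k ih =>
      intro hk g' hg' h0'
      obtain ⟨g'', hg'', h0''⟩ := exists_isPrimitive ho hc hκ (horizontal Φ (k / (N + 1)))
      rw [← ih (by omega) g'' hg'' h0'']
      refine step (k / (N + 1)) ⟨by positivity, (div_le_one hN0).2 ?_⟩ _ ?_ _ _ hg'' hg' h0'' h0'
      · exact_mod_cast (by omega : k ≤ N + 1)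
      · have : ((k + 1 : ℕ) : ℝ) / (N + 1) - k / (N + 1) = 1 / (N + 1) := by push_cast; ring
        rw [this, abs_of_pos (one_div_pos.2 hN0)]
        exact hN
  refine (key (N + 1) le_rfl g' ?_ hg0').symm
  have h1 : ((N + 1 : ℕ) : ℝ) / (N + 1) = 1 := by push_cast; exact div_self hN0.ne'
  rwa [h1]

/-- The constant extension of a path to the real line. -/
noncomputable def pathExtend (γ : C(I, Y)) : C(ℝ, Y) := γ.IccExtend zero_le_one

theorem pathExtend_of_mem (γ : C(I, Y)) {t : ℝ} (ht : t ∈ I) : pathExtend γ t = γ ⟨t, ht⟩ :=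
  IccExtend_of_mem _ _ ht

theorem imageSegment_pathExtend (γ : C(I, Y)) :
    (imageSegment (pathExtend γ) 0 1 : C(I, Y)) = γ := by
  ext t
  have : pathExtend γ t = γ t := pathExtend_of_mem γ t.2
  simpa [imageSegment, Path.segment_apply, AffineMap.lineMap_apply] using this

theorem IsPrimitive.unique (ho : ∀ i, IsOpen (𝒰 i)) (hc : ∀ y, ∃ i, y ∈ 𝒰 i)
    (hκ : ∀ i, IsCocycleOn κ (𝒰 i)) {φ : C(ℝ, Y)} {g g' : ℝ → H}
    (hg : IsPrimitive 𝒰 κ φ g 0 1) (hg' : IsPrimitive 𝒰 κ φ g' 0 1) (hg0 : g 0 = 1)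
    (hg0' : g' 0 = 1) : g 1 = g' 1 :=
  IsPrimitive.eq_of_vertical_const ho hc hκ (φ.comp ⟨Prod.fst, continuous_fst⟩)
    (x := φ 0) (y := φ 1) (fun _ => rfl) (fun _ => rfl) hg hg' hg0 hg0'

theorem IsPrimitive.comp_affine {φ ψ : C(ℝ, Y)} {g : ℝ → H} {a b c d : ℝ} (hc : 0 < c)
    (hg : IsPrimitive 𝒰 κ φ g (c * a + d) (c * b + d))
    (hφ : ∀ t ∈ Icc a b, ψ t = φ (c * t + d)) :
    IsPrimitive 𝒰 κ ψ (fun t => g (c * t + d)) a b := by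
  intro s t has hst htb i hi
  have h1 : κ (imageSegment ψ s t) = κ (imageSegment φ (c * s + d) (c * t + d)) := by
    congr 1
    ext u
    have hu : AffineMap.lineMap s t (u : ℝ) ∈ Icc a b :=
      (convex_Icc a b).lineMap_mem ⟨has, hst.trans htb⟩ ⟨has.trans hst, htb⟩ u.2
    have := hφ _ hu
    simp only [imageSegment, Path.map_coe, ContinuousMap.coe_coe, Function.comp_apply,
      Path.segment_apply, this]
    congr 1
    simp only [AffineMap.lineMap_apply_module, smul_eq_mul]
    ring
  rw [h1]
  refine hg _ _ (by nlinarith) (by nlinarith) (by nlinarith) i ?_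
  rintro _ ⟨x, hx, rfl⟩
  refine hi ⟨(x - d) / c, ⟨(le_div_iff₀ hc).2 (by linarith [hx.1]),
    (div_le_iff₀ hc).2 (by linarith [hx.2])⟩, ?_⟩
  rw [hφ _ ⟨has.trans ((le_div_iff₀ hc).2 (by linarith [hx.1])),
    ((div_le_iff₀ hc).2 (by linarith [hx.2])).trans htb⟩]
  congr 1
  field_simp
  ring

theorem IsPrimitive.trans (hκ : ∀ i, IsCocycleOn κ (𝒰 i)) {x y z : Y} (γ : Path x y)
    (γ' : Path y z) {g g' : ℝ → H} (hg : IsPrimitive 𝒰 κ (pathExtend γ) g 0 1)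
    (hg' : IsPrimitive 𝒰 κ (pathExtend γ') g' 0 1) (hg0' : g' 0 = 1) :
    IsPrimitive 𝒰 κ (pathExtend (γ.trans γ'))
      (fun t => if t ≤ 1 / 2 then g (2 * t) else g' (2 * t - 1) * g 1) 0 1 := by
  refine IsPrimitive.glue hκ (b := 1 / 2) ?_ ?_
  · refine IsPrimitive.congr (g := fun t => g (2 * t + 0)) (IsPrimitive.comp_affine two_pos
      (φ := pathExtend γ) (by simpa using hg) fun t ht => ?_)
      fun t ht => by simp only [if_pos ht.2, add_zero]
    rw [pathExtend_of_mem _ ⟨ht.1, by linarith [ht.2]⟩,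
      pathExtend_of_mem _ ⟨by linarith [ht.1], by linarith [ht.2]⟩]
    simp [Path.trans_apply, ht.2.trans_eq (one_div _)]
  · refine IsPrimitive.congr (g := fun t => g' (2 * t + -1) * g 1) ((IsPrimitive.comp_affine
      (φ := pathExtend γ') two_pos (by convert hg' using 1 <;> norm_num)
      fun t ht => ?_).mul_right _) fun t ht => ?_
    · rw [pathExtend_of_mem _ ⟨by linarith [ht.1], by linarith [ht.2]⟩,
        pathExtend_of_mem _ ⟨by linarith [ht.1], by linarith [ht.2]⟩]
      have h := ht.1
      rcases h.eq_or_lt with h | h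
      · subst h
        simp [Path.trans_apply]
      · have h' : ¬ t ≤ 1 / 2 := h.not_ge
        simp only [ContinuousMap.coe_coe, Path.trans_apply, h', dite_false]
        congr 2
    · rcases ht.1.eq_or_lt with h | h
      · subst h
        norm_num [hg0']
      · simp only [if_neg h.not_ge, sub_eq_add_neg]

/-- **Van Kampen for path cocycles**: a cocycle defined on the paths contained in the members of
an open cover extends to all paths. -/
theorem exists_cocycle_extension (ho : ∀ i, IsOpen (𝒰 i)) (hc : ∀ y, ∃ i, y ∈ 𝒰 i)
    (hκ : ∀ i, IsCocycleOn κ (𝒰 i)) :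
    ∃ κ' : C(I, Y) → H, IsCocycleOn κ' univ ∧
      ∀ (γ : C(I, Y)) (i : ι), range γ ⊆ 𝒰 i → κ' γ = κ γ := by
  choose g hg hg0 using fun γ : C(I, Y) => exists_isPrimitive ho hc hκ (pathExtend γ)
  refine ⟨fun γ => g γ 1, ⟨?_, ?_⟩, ?_⟩
  · intro x y z γ γ' _ _
    have := IsPrimitive.unique ho hc hκ (hg (γ.trans γ'))
      (IsPrimitive.trans hκ γ γ' (hg γ) (hg γ') (hg0 γ')) (hg0 _) (by norm_num [hg0])
    simp only [this]
    norm_num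
  · intro x y γ γ' F _
    let Φ : C(ℝ × ℝ, Y) := ⟨fun z => F (projIcc 0 1 zero_le_one z.2, projIcc 0 1 zero_le_one z.1),
      by fun_prop⟩
    refine IsPrimitive.eq_of_vertical_const ho hc hκ Φ (x := x) (y := y) (by simp [Φ]) (by simp [Φ])
      (g := g γ) (g' := g γ') ?_ ?_ (hg0 _) (hg0 _)
    · convert hg γ using 1
      ext t
      simp [Φ, horizontal, pathExtend, IccExtend]
    · convert hg γ' using 1
      ext t
      simp [Φ, horizontal, pathExtend, IccExtend]
  · intro γ i hi
    have := hg γ 0 1 le_rfl zero_le_one le_rfl i (by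
      rintro _ ⟨t, ht, rfl⟩
      rw [pathExtend_of_mem _ ht]
      exact hi ⟨_, rfl⟩)
    rwa [hg0, mul_one, imageSegment_pathExtend] at this

theorem IsCocycleOn.ext_of_cover (ho : ∀ i, IsOpen (𝒰 i)) (hc : ∀ y, ∃ i, y ∈ 𝒰 i)
    {κ' : C(I, Y) → H} (hκ : IsCocycleOn κ univ) (hκ' : IsCocycleOn κ' univ)
    (h : ∀ (γ : C(I, Y)) (i : ι), range γ ⊆ 𝒰 i → κ' γ = κ γ) : κ' = κ := by
  have hκU : ∀ i, IsCocycleOn κ (𝒰 i) := fun i =>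
    ⟨fun γ γ' _ _ => hκ.trans γ γ' (subset_univ _) (subset_univ _),
      fun γ γ' F _ => hκ.homotopic γ γ' F (subset_univ _)⟩
  funext γ
  have aux : ∀ κ'' : C(I, Y) → H, IsCocycleOn κ'' univ →
      (∀ (γ : C(I, Y)) (i : ι), range γ ⊆ 𝒰 i → κ'' γ = κ γ) →
      IsPrimitive 𝒰 κ (pathExtend γ) (fun t => κ'' (imageSegment (pathExtend γ) 0 t)) 0 1 ∧
        κ'' (imageSegment (pathExtend γ) 0 0) = 1 := by
    intro κ'' hκ'' h''
    refine ⟨fun s t hs hst ht i hi => ?_, ?_⟩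
    · have e : κ'' (imageSegment (pathExtend γ) s t) = κ (imageSegment (pathExtend γ) s t) :=
        h'' _ i (range_imageSegment_subset (convex_Icc s t) (left_mem_Icc.2 hst)
          (right_mem_Icc.2 hst) hi)
      simp only
      rw [hκ''.imageSegment_trans convex_univ _ (subset_univ _) (mem_univ _) (mem_univ s)
        (mem_univ _), e]
    · exact hκ''.const (mem_univ (pathExtend γ 0)) fun t => by simp [imageSegment]
  obtain ⟨h1, h1'⟩ := aux κ hκ fun _ _ _ => rfl
  obtain ⟨h2, h2'⟩ := aux κ' hκ' h
  have := IsPrimitive.unique ho hc hκU h2 h1 h2' h1'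
  simpa only [imageSegment_pathExtend] using this

end PathCocycle

section VanKampen

open CategoryTheory Monoid.Coprod

variable {Y : Type*} [TopologicalSpace Y]

theorem functor_map_groupoid_inv {C D : Type*} [Groupoid C] [Groupoid D] (F : C ⥤ D) {x y : C}
    (f : x ⟶ y) : F.map (Groupoid.inv f) = Groupoid.inv (F.map f) := by
  simp [Groupoid.inv_eq_inv]

theorem groupoid_inv_comp_assoc {C : Type*} [Groupoid C] {x y z : C} (f : x ⟶ y) (g : y ⟶ z) :
    Groupoid.inv f ≫ f ≫ g = g := by
  simp [Groupoid.inv_eq_inv]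

theorem groupoid_conj_comp_conj {C : Type*} [Groupoid C] {o n m' m y : C} (t : o ⟶ n)
    (v : n ⟶ m) (a : m' ⟶ m) (e : m ⟶ y) (b : m' ⟶ y) :
    (t ≫ v ≫ Groupoid.inv a) ≫ a ≫ e ≫ Groupoid.inv b = t ≫ (v ≫ e) ≫ Groupoid.inv b := by
  simp [Groupoid.inv_eq_inv]

/-- The morphism of the fundamental groupoid given by a path. -/
def pathClass {x y : Y} (γ : Path x y) : FundamentalGroupoid.mk x ⟶ FundamentalGroupoid.mk y :=
  Path.Homotopic.Quotient.mk γ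

theorem pathClass_trans {x y z : Y} (γ : Path x y) (γ' : Path y z) :
    pathClass (γ.trans γ') = pathClass γ ≫ pathClass γ' := rfl

theorem pathClass_surjective {x y : Y} (f : FundamentalGroupoid.mk x ⟶ FundamentalGroupoid.mk y) :
    ∃ γ : Path x y, pathClass γ = f := Path.Homotopic.Quotient.mk_surjective f

/-- The loop at `y₀` obtained from a path by means of the connecting morphisms `T`. -/
noncomputable def connectedLoop {y₀ : Y}
    (T : ∀ y, FundamentalGroupoid.mk y₀ ⟶ FundamentalGroupoid.mk y)
    (γ : C(I, Y)) : FundamentalGroup Y y₀ :=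
  T (γ 0) ≫ pathClass (x := γ 0) (y := γ 1) ⟨γ, rfl, rfl⟩ ≫ Groupoid.inv (T (γ 1))

theorem connectedLoop_path {y₀ : Y}
    (T : ∀ y, FundamentalGroupoid.mk y₀ ⟶ FundamentalGroupoid.mk y) {x y : Y} (γ : Path x y) :
    connectedLoop T γ = T x ≫ pathClass γ ≫ Groupoid.inv (T y) := by
  rcases γ with ⟨γ, rfl, rfl⟩
  rfl

theorem isCocycleOn_connectedLoop {y₀ : Y}
    (T : ∀ y, FundamentalGroupoid.mk y₀ ⟶ FundamentalGroupoid.mk y) :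
    IsCocycleOn (connectedLoop T) univ where
  trans γ γ' _ _ := by
    rw [connectedLoop_path, connectedLoop_path, connectedLoop_path, pathClass_trans, End.mul_def]
    simp
  homotopic γ γ' F _ := by
    rw [connectedLoop_path, connectedLoop_path]
    congr 2
    exact Path.Homotopic.Quotient.eq.2 ⟨F⟩

theorem exists_paths_of_isSimplyConnected {S : Set Y} (hS : IsSimplyConnected S) {m : Y}
    (hm : m ∈ S) :
    ∃ P : ∀ v ∈ S, Path m v, (∀ v hv, range (P v hv) ⊆ S) ∧ pathClass (P m hm) = 𝟙 _ ∧
      ∀ (x y : Y) (hx : x ∈ S) (hy : y ∈ S) (γ : Path x y), range γ ⊆ S →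
        pathClass (P x hx) ≫ pathClass γ = pathClass (P y hy) := by
  have := hS.simplyConnectedSpace
  let P : ∀ v ∈ S, Path m v := fun v hv =>
    (PathConnectedSpace.somePath (⟨m, hm⟩ : S) ⟨v, hv⟩).map continuous_subtype_val
  have hP : ∀ v hv, range (P v hv) ⊆ S := by
    rintro v hv _ ⟨t, rfl⟩
    exact Subtype.property _
  have key : ∀ (x y : Y) (hx : x ∈ S) (hy : y ∈ S) (γ : Path x y), range γ ⊆ S →
      pathClass (P x hx) ≫ pathClass γ = pathClass (P y hy) := by
    intro x y hx hy γ hγ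
    let γ' : Path (⟨x, hx⟩ : S) ⟨y, hy⟩ :=
      ⟨⟨fun t => ⟨γ t, hγ ⟨t, rfl⟩⟩, by fun_prop⟩, by simp, by simp⟩
    have h : γ = γ'.map continuous_subtype_val := by ext; rfl
    rw [h, ← pathClass_trans, ← Path.map_trans]
    exact Path.Homotopic.Quotient.eq.2
      ((SimplyConnectedSpace.paths_homotopic _ _).map ⟨_, continuous_subtype_val⟩)
  refine ⟨P, hP, ?_, key⟩
  have := key m m hm hm (P m hm) (hP m hm)
  rwa [← cancel_epi (pathClass (P m hm)), Category.comp_id]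

/-- The value of a path cocycle on a morphism of the fundamental groupoid. -/
noncomputable def cocycleValue {H : Type*} [Group H] {κ : C(I, Y) → H} (hκ : IsCocycleOn κ univ)
    {x y : Y}
    (f : FundamentalGroupoid.mk x ⟶ FundamentalGroupoid.mk y) : H :=
  Quotient.lift (s := Path.Homotopic.setoid x y) (fun γ : Path x y => κ γ)
    (fun γ γ' h => h.elim fun F => hκ.homotopic γ γ' F (subset_univ _)) f

section cocycleValue

variable {H : Type*} [Group H] {κ : C(I, Y) → H} (hκ : IsCocycleOn κ univ)

theorem cocycleValue_pathClass {x y : Y} (γ : Path x y) :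
    cocycleValue hκ (pathClass γ) = κ γ := rfl

theorem cocycleValue_comp {x y z : Y} (f : FundamentalGroupoid.mk x ⟶ FundamentalGroupoid.mk y)
    (g : FundamentalGroupoid.mk y ⟶ FundamentalGroupoid.mk z) :
    cocycleValue hκ (f ≫ g) = cocycleValue hκ g * cocycleValue hκ f := by
  obtain ⟨γ, rfl⟩ := pathClass_surjective f
  obtain ⟨γ', rfl⟩ := pathClass_surjective g
  rw [← pathClass_trans]
  exact hκ.trans γ γ' (subset_univ _) (subset_univ _)

theorem cocycleValue_inv {x y : Y} (f : FundamentalGroupoid.mk x ⟶ FundamentalGroupoid.mk y) :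
    cocycleValue hκ (Groupoid.inv f) = (cocycleValue hκ f)⁻¹ := by
  have h1 : cocycleValue hκ (𝟙 (FundamentalGroupoid.mk x)) = 1 := hκ.refl (mem_univ x)
  have h := cocycleValue_comp hκ f (Groupoid.inv f)
  rw [Groupoid.comp_inv, h1] at h
  exact eq_inv_of_mul_eq_one_left h.symm

/-- A path cocycle induces a homomorphism from the fundamental group. -/
noncomputable def cocycleHom (y₀ : Y) : FundamentalGroup Y y₀ →* H :=
  MonoidHom.mk' (fun f => cocycleValue hκ f) fun f g => cocycleValue_comp hκ g f

end cocycleValue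

/-- Restriction of the codomain of a path. -/
def pathRestrict {U : Set Y} (γ : C(I, Y)) (h : range γ ⊆ U) : C(I, U) :=
  ⟨fun t => ⟨γ t, h ⟨t, rfl⟩⟩, by fun_prop⟩

theorem IsCocycleOn.of_subtype {H : Type*} [Group H] {U : Set Y} {κ : C(I, U) → H}
    (hκ : IsCocycleOn κ univ) {κ' : C(I, Y) → H}
    (h : ∀ (γ : C(I, Y)) (hγ : range γ ⊆ U), κ' γ = κ (pathRestrict γ hγ)) : IsCocycleOn κ' U where
  trans {x y z} γ γ' hγ hγ' := by
    have hγγ' : range (γ.trans γ') ⊆ U := by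
      rw [Path.trans_range]
      exact union_subset hγ hγ'
    let δ : Path (⟨x, hγ ⟨0, γ.source⟩⟩ : U) ⟨y, hγ ⟨1, γ.target⟩⟩ :=
      ⟨pathRestrict γ hγ, by simp [pathRestrict], by simp [pathRestrict]⟩
    let δ' : Path (⟨y, hγ ⟨1, γ.target⟩⟩ : U) ⟨z, hγ' ⟨1, γ'.target⟩⟩ :=
      ⟨pathRestrict γ' hγ', by simp [pathRestrict], by simp [pathRestrict]⟩
    have e := hκ.trans δ δ' (subset_univ _) (subset_univ _)
    have e' : (δ.trans δ' : C(I, U)) = pathRestrict (γ.trans γ') hγγ' := by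
      ext t
      have := congrArg (fun p => p t) (Path.map_trans δ δ' continuous_subtype_val)
      refine this.trans ?_
      rfl
    have e₁ : κ' (γ.trans γ') = _ := h _ hγγ'
    have e₂ : κ' γ = _ := h _ hγ
    have e₃ : κ' γ' = _ := h _ hγ'
    rw [e₁, e₂, e₃]
    exact (congrArg κ e').symm.trans e
  homotopic {x y} γ γ' F hF := by
    have hγ : range γ ⊆ U := by
      rintro _ ⟨t, rfl⟩
      exact hF ⟨(0, t), by simp⟩
    have hγ' : range γ' ⊆ U := by
      rintro _ ⟨t, rfl⟩
      exact hF ⟨(1, t), by simp⟩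
    let δ : Path (⟨x, hγ ⟨0, γ.source⟩⟩ : U) ⟨y, hγ ⟨1, γ.target⟩⟩ :=
      ⟨pathRestrict γ hγ, by simp [pathRestrict], by simp [pathRestrict]⟩
    let δ' : Path (⟨x, hγ ⟨0, γ.source⟩⟩ : U) ⟨y, hγ ⟨1, γ.target⟩⟩ :=
      ⟨pathRestrict γ' hγ', by simp [pathRestrict], by simp [pathRestrict]⟩
    let G : δ.Homotopy δ' :=
      { toFun := fun z => ⟨F z, hF ⟨z, rfl⟩⟩
        continuous_toFun := by fun_prop
        map_zero_left := fun t => Subtype.ext (F.apply_zero t)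
        map_one_left := fun t => Subtype.ext (F.apply_one t)
        prop' := fun t z hz => Subtype.ext (F.prop' t z hz) }
    have e₂ : κ' γ = _ := h _ hγ
    have e₃ : κ' γ' = _ := h _ hγ'
    rw [e₂, e₃]
    exact hκ.homotopic δ δ' G (subset_univ _)

theorem IsCocycleOn.of_coboundary {H : Type*} [Group H] {V : Set Y} {κ : C(I, Y) → H} (c : Y → H)
    (h : ∀ γ : C(I, Y), range γ ⊆ V → κ γ = c (γ 1) * (c (γ 0))⁻¹) : IsCocycleOn κ V where
  trans γ γ' hγ hγ' := by
    have hγγ' : range (γ.trans γ') ⊆ V := by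
      rw [Path.trans_range]
      exact union_subset hγ hγ'
    have e₁ : κ (γ.trans γ') = _ := h _ hγγ'
    have e₂ : κ γ = _ := h _ hγ
    have e₃ : κ γ' = _ := h _ hγ'
    rw [e₁, e₂, e₃]
    simp
  homotopic γ γ' F hF := by
    rw [h γ, h γ']
    · simp
    · rintro _ ⟨t, rfl⟩
      exact hF ⟨(1, t), by simp⟩
    · rintro _ ⟨t, rfl⟩
      exact hF ⟨(0, t), by simp⟩

theorem exists_subset_of_range_subset_iUnion {ι : Type*} {M : ι → Set Y} (hM : ∀ b, IsOpen (M b))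
    (hd : Pairwise (Function.onFun Disjoint M)) {γ : C(I, Y)} (h : range γ ⊆ ⋃ b, M b) :
    ∃ b, range γ ⊆ M b := by
  obtain ⟨b, hb⟩ := mem_iUnion.1 (h ⟨0, rfl⟩)
  refine ⟨b, (isPreconnected_range γ.continuous).subset_left_of_subset_union (hM b)
    (isOpen_iUnion fun b' : {b' // b' ≠ b} => hM b') ?_ ?_ ⟨_, ⟨0, rfl⟩, hb⟩⟩
  · exact disjoint_iUnion_right.2 fun b' => hd b'.2.symm
  · intro y hy
    obtain ⟨b', hb'⟩ := mem_iUnion.1 (h hy)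
    by_cases e : b' = b
    · exact Or.inl (e ▸ hb')
    · exact Or.inr (mem_iUnion.2 ⟨⟨b', e⟩, hb'⟩)

open Classical in
/-- Attaching simply connected open sets `N a` to a path connected open set `U` along the
disjoint unions of simply connected open sets `M a b` adds free generators to `π₁`. -/
theorem fundamentalGroup_attach {A B : Type*} {U : Set Y} {N : A → Set Y}
    {M : A → Option B → Set Y} (hU : IsOpen U) (hN : ∀ a, IsOpen (N a))
    (hM : ∀ a b, IsOpen (M a b)) (hcov : ∀ y, y ∈ U ∨ ∃ a, y ∈ N a)
    (hNd : Pairwise (Function.onFun Disjoint N))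
    (hMd : ∀ a, Pairwise (Function.onFun Disjoint (M a)))
    (hUN : ∀ a, U ∩ N a = ⋃ b, M a b) (hUc : IsPathConnected U)
    (hNs : ∀ a, IsSimplyConnected (N a)) (hMs : ∀ a b, IsSimplyConnected (M a b)) (u : U) :
    Nonempty (FundamentalGroup Y (u : Y) ≃*
      Monoid.Coprod (FundamentalGroup U u) (FreeGroup (A × B))) := by
  have hUc' : PathConnectedSpace U := isPathConnected_iff_pathConnectedSpace.1 hUc
  have hMU : ∀ a b, M a b ⊆ U := fun a b => (subset_iUnion (M a) b).trans
    ((hUN a).symm.subset.trans inter_subset_left)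
  have hMN : ∀ a b, M a b ⊆ N a := fun a b => (subset_iUnion (M a) b).trans
    ((hUN a).symm.subset.trans inter_subset_right)
  let K := Monoid.Coprod (FundamentalGroup U u) (FreeGroup (A × B))
  let incl : C(U, Y) := ⟨_, continuous_subtype_val⟩
  -- base points of the intersections
  choose m hm using fun a b => (hMs a b).nonempty
  let mU : A → Option B → U := fun a b => ⟨m a b, hMU a b (hm a b)⟩
  -- connecting morphisms
  obtain ⟨T, hT⟩ : ∃ T : ∀ v : U, FundamentalGroupoid.mk u ⟶ FundamentalGroupoid.mk v,
      T u = 𝟙 _ := by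
    refine ⟨fun v => if h : v = u then eqToHom (by rw [h]) else
      pathClass (PathConnectedSpace.somePath u v), by simp⟩
  have hMs' : ∀ a b, IsSimplyConnected ((↑) ⁻¹' M a b : Set U) := by
    intro a b
    rw [← Topology.IsEmbedding.subtypeVal.isSimplyConnected_image, Subtype.image_preimage_coe,
      inter_eq_right.2 (hMU a b)]
    exact hMs a b
  choose E hE hEm hEγ using fun a b =>
    exists_paths_of_isSimplyConnected (hMs' a b) (m := mU a b) (hm a b)
  choose ν hν hνm hνγ using fun a =>
    exists_paths_of_isSimplyConnected (hNs a) (hMN a none (hm a none))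
  let g : A → Option B → K := fun a b => b.elim 1 fun b => inr (FreeGroup.of (a, b))
  let cM : ∀ a b v, v ∈ M a b → FundamentalGroup U u := fun a b v hv =>
    T (mU a b) ≫ pathClass (E a b ⟨v, hMU a b hv⟩ hv) ≫ Groupoid.inv (T ⟨v, hMU a b hv⟩)
  let c : A → Y → K := fun a v => if h : ∃ b, v ∈ M a b then
    inl (cM a h.choose v h.choose_spec) * g a h.choose else 1
  have hcM : ∀ a b v (hv : v ∈ M a b), c a v = inl (cM a b v hv) * g a b := by
    intro a b v hv
    have h : ∃ b, v ∈ M a b := ⟨b, hv⟩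
    have hb : h.choose = b := by
      by_contra hne
      exact (disjoint_left.1 (hMd a hne)) h.choose_spec hv
    have : c a v = inl (cM a h.choose v h.choose_spec) * g a h.choose := dif_pos h
    rw [this]
    congr! 3
  have hcm : ∀ a b, c a (m a b) = g a b := by
    intro a b
    rw [hcM a b _ (hm a b)]
    have : cM a b (m a b) (hm a b) = 1 := by
      have := hEm a b
      simp only [cM]
      erw [this]
      rw [Category.id_comp]
      exact Groupoid.comp_inv _
    rw [this, map_one, one_mul]
  -- the local cocycle
  let κ : C(I, Y) → K := fun γ => if h : range γ ⊆ U then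
      inl (connectedLoop T (pathRestrict γ h))
    else if h : ∃ a, range γ ⊆ N a then c h.choose (γ 1) * (c h.choose (γ 0))⁻¹ else 1
  have hκU : ∀ (γ : C(I, Y)) (h : range γ ⊆ U), κ γ = inl (connectedLoop T (pathRestrict γ h)) :=
    fun γ h => dif_pos h
  have hκN : ∀ a (γ : C(I, Y)), range γ ⊆ N a → κ γ = c a (γ 1) * (c a (γ 0))⁻¹ := by
    intro a γ h
    by_cases hγU : range γ ⊆ U
    · obtain ⟨b, hb⟩ := exists_subset_of_range_subset_iUnion (hM a) (hMd a)
        ((subset_inter hγU h).trans (hUN a).subset)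
      have h0 := hb ⟨0, rfl⟩
      have h1 := hb ⟨1, rfl⟩
      rw [hκU _ hγU, hcM a b _ h0, hcM a b _ h1, mul_inv_rev, mul_assoc, mul_inv_cancel_left,
        ← map_inv, ← map_mul]
      congr 1
      rw [eq_mul_inv_iff_mul_eq, End.mul_def]
      have := hEγ a b ⟨_, hMU a b h0⟩ ⟨_, hMU a b h1⟩ h0 h1
        ⟨pathRestrict γ hγU, rfl, rfl⟩ (by
          rintro _ ⟨t, rfl⟩
          exact hb ⟨t, rfl⟩)
      simp only [cM, ← this, Category.assoc]
      congr 2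
      have h3 : ∀ (x y : U) (γ : Path x y), Groupoid.inv (T x) ≫ connectedLoop T γ =
          pathClass γ ≫ Groupoid.inv (T y) := by
        intro x y γ
        rw [connectedLoop_path, ← Category.assoc, Groupoid.inv_comp, Category.id_comp]
      exact h3 _ _ ⟨pathRestrict γ hγU, rfl, rfl⟩
    · have h' : ∃ a, range γ ⊆ N a := ⟨a, h⟩
      have ha : h'.choose = a := by
        by_contra hne
        exact (disjoint_left.1 (hNd hne)) (h'.choose_spec ⟨0, rfl⟩) (h ⟨0, rfl⟩)
      have : κ γ = c h'.choose (γ 1) * (c h'.choose (γ 0))⁻¹ := by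
        simp only [κ]
        rw [dif_neg hγU, dif_pos h']
      rw [this, ha]
  let 𝒰 : Option A → Set Y := fun a => a.elim U N
  have ho : ∀ i, IsOpen (𝒰 i) := by
    rintro (_ | a)
    exacts [hU, hN a]
  have hc : ∀ y, ∃ i, y ∈ 𝒰 i := by
    intro y
    rcases hcov y with h | ⟨a, h⟩
    exacts [⟨none, h⟩, ⟨some a, h⟩]
  have hκ : ∀ i, IsCocycleOn κ (𝒰 i) := by
    rintro (_ | a)
    · refine IsCocycleOn.of_subtype (κ := fun γ => inl (connectedLoop T γ)) ?_ hκU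
      have := isCocycleOn_connectedLoop T
      exact ⟨fun γ γ' h h' => by rw [this.trans γ γ' h h', map_mul],
        fun γ γ' F h => by rw [this.homotopic γ γ' F h]⟩
    · exact IsCocycleOn.of_coboundary (c a) (hκN a)
  obtain ⟨κ', hκ', hκκ'⟩ := exists_cocycle_extension ho hc hκ
  let Ψ := cocycleHom hκ' (u : Y)
  -- connecting morphisms in the whole space
  let TU : ∀ y, y ∈ U → (FundamentalGroupoid.mk (u : Y) ⟶ FundamentalGroupoid.mk y) :=
    fun y hy => (FundamentalGroupoid.map incl).map (T ⟨y, hy⟩)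
  let T' : ∀ y, FundamentalGroupoid.mk (u : Y) ⟶ FundamentalGroupoid.mk y := fun y =>
    if h : y ∈ U then TU y h else
      TU (m ((hcov y).resolve_left h).choose none) (hMU _ _ (hm _ _)) ≫
        pathClass (ν _ y ((hcov y).resolve_left h).choose_spec)
  have hT'U : ∀ y hy, T' y = TU y hy := fun y hy => dif_pos hy
  have hT'N : ∀ y a (ha : y ∈ N a), y ∉ U → T' y = T' (m a none) ≫ pathClass (ν a y ha) := by
    intro y a ha hy
    have : ((hcov y).resolve_left hy).choose = a := by
      by_contra hne
      exact (disjoint_left.1 (hNd hne)) ((hcov y).resolve_left hy).choose_spec ha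
    have e : T' y = _ := dif_neg hy
    rw [e, hT'U _ (hMU _ _ (hm a none))]
    congr!
  let Φ : K →* FundamentalGroup Y (u : Y) := Monoid.Coprod.lift (FundamentalGroup.map incl u)
    (FreeGroup.lift fun ab => T' (m ab.1 none) ≫
      pathClass (ν ab.1 (m ab.1 (some ab.2)) (hMN _ _ (hm _ _))) ≫
        Groupoid.inv (T' (m ab.1 (some ab.2))))
  have hΦg : ∀ a b, Φ (g a b) = T' (m a none) ≫ pathClass (ν a (m a b) (hMN _ _ (hm _ _))) ≫
      Groupoid.inv (T' (m a b)) := by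
    rintro a (_ | b)
    · rw [hνm]
      simp only [g, Option.elim, map_one, Category.id_comp, Groupoid.comp_inv]
      rfl
    · exact (lift_apply_inr _ _ _).trans FreeGroup.lift_apply_of
  have hΦinl : ∀ f, Φ (inl f) = (FundamentalGroupoid.map incl).map f := fun f => by
    exact lift_apply_inl _ _ _
  have hΦc : ∀ a y (hy : y ∈ N a), Φ (c a y) =
      T' (m a none) ≫ pathClass (ν a y hy) ≫ Groupoid.inv (T' y) := by
    intro a y hy
    by_cases hyM : ∃ b, y ∈ M a b
    · obtain ⟨b, hb⟩ := hyM
      rw [hcM a b y hb, map_mul, hΦinl, hΦg]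
      refine (End.mul_def _ _).trans ?_
      simp only [cM]
      rw [Functor.map_comp, Functor.map_comp, functor_map_groupoid_inv]
      rw [hT'U _ (hMU _ _ (hm a b)), hT'U _ (hMU _ _ hb)]
      have e := hνγ a (m a b) y (hMN _ _ (hm a b)) hy
        ((E a b ⟨y, hMU a b hb⟩ hb).map continuous_subtype_val) (by
          rintro _ ⟨t, rfl⟩
          exact hMN a b (hE a b _ hb ⟨t, rfl⟩))
      rw [← e]
      exact groupoid_conj_comp_conj _ _ _ _ _
    · have hyU : y ∉ U := fun h => hyM (mem_iUnion.1 ((hUN a).subset ⟨h, hy⟩))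
      have : c a y = 1 := dif_neg hyM
      rw [this, map_one, hT'N y a hy hyU, ← Category.assoc, Groupoid.comp_inv]
      rfl
  have hΦκ : (fun γ => Φ (κ' γ)) = connectedLoop T' := by
    refine IsCocycleOn.ext_of_cover ho hc (isCocycleOn_connectedLoop T') ⟨?_, ?_⟩ ?_
    · intro x y z γ γ' h h'
      simp only [hκ'.trans γ γ' h h', map_mul]
    · intro x y γ γ' F h
      simp only [hκ'.homotopic γ γ' F h]
    · rintro γ (_ | a) hγ
      · rw [hκκ' γ none hγ, hκU γ hγ, hΦinl]
        have e : ∀ (x y : U) (γ : Path x y), (FundamentalGroupoid.map incl).map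
            (connectedLoop T γ) = T' x ≫ pathClass (γ.map continuous_subtype_val) ≫
              Groupoid.inv (T' y) := by
          intro x y γ
          rw [connectedLoop_path, Functor.map_comp, Functor.map_comp, functor_map_groupoid_inv,
            hT'U x x.2, hT'U y y.2]
          rfl
        exact e _ _ ⟨pathRestrict γ hγ, rfl, rfl⟩
      · rw [hκκ' γ (some a) hγ, hκN a γ hγ, map_mul, map_inv, mul_inv_eq_iff_eq_mul, End.mul_def,
          hΦc a _ (hγ ⟨1, rfl⟩), hΦc a _ (hγ ⟨0, rfl⟩),
          ← hνγ a (γ 0) (γ 1) (hγ ⟨0, rfl⟩) (hγ ⟨1, rfl⟩) ⟨γ, rfl, rfl⟩ hγ]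
        simp only [connectedLoop, Category.assoc, groupoid_inv_comp_assoc]
  have hT'u : T' u = 𝟙 _ := by
    rw [hT'U u u.2]
    simp only [TU, hT]
    exact CategoryTheory.Functor.map_id _ _
  refine ⟨MonoidHom.toMulEquiv Ψ Φ ?_ ?_⟩
  · ext f
    obtain ⟨γ, rfl⟩ := pathClass_surjective f
    have h1 : Φ (Ψ (pathClass γ)) = connectedLoop T' γ := congrFun hΦκ γ
    rw [MonoidHom.comp_apply, h1, connectedLoop_path, hT'u]
    simp only [Category.id_comp, MonoidHom.id_apply]
    exact (congrArg (pathClass γ ≫ ·) (Groupoid.inv_eq_inv (𝟙 _))).trans (by simp)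
  · have hval : ∀ (x y : U) (γ : Path x y),
        κ' (γ.map continuous_subtype_val) = inl (connectedLoop T γ) := by
      intro x y γ
      have h : range ((γ.map continuous_subtype_val : Path (x : Y) y) : C(I, Y)) ⊆ U := by
        rintro _ ⟨t, rfl⟩
        exact Subtype.property _
      rw [hκκ' _ none h, hκU _ h]
      rfl
    refine Monoid.Coprod.hom_ext ?_ ?_
    · ext f
      obtain ⟨γ, rfl⟩ := pathClass_surjective f
      have h1 : Φ (inl (pathClass γ)) = pathClass (γ.map continuous_subtype_val) := hΦinl _
      simp only [MonoidHom.comp_apply, h1, MonoidHom.id_apply]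
      refine (hval u u γ).trans ?_
      rw [connectedLoop_path, hT]
      congr 1
      simp only [Category.id_comp]
      exact (congrArg (pathClass γ ≫ ·) (Groupoid.inv_eq_inv (𝟙 _))).trans (by simp)
    · ext ⟨a, b⟩
      have h1 : Φ (inr (FreeGroup.of (a, b))) = _ := hΦg a (some b)
      have hTm : ∀ b, cocycleValue hκ' (T' (m a b)) = 1 := by
        intro b
        rw [hT'U _ (hMU a b (hm a b))]
        obtain ⟨γ, hγ⟩ := pathClass_surjective (T (mU a b))
        have : TU (m a b) (hMU a b (hm a b)) = pathClass (γ.map continuous_subtype_val) := by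
          simp only [TU]
          erw [← hγ]
          rfl
        rw [this, cocycleValue_pathClass, hval, connectedLoop_path, hT, hγ, Groupoid.comp_inv,
          Category.id_comp]
        exact map_one _
      have hνv : cocycleValue hκ' (pathClass (ν a (m a (some b)) (hMN _ _ (hm _ _)))) =
          g a (some b) := by
        have e₁ : κ' (ν a (m a (some b)) (hMN _ _ (hm _ _))) = _ := hκκ' _ (some a) (hν a _ _)
        have e₂ : κ (ν a (m a (some b)) (hMN _ _ (hm _ _))) = _ := hκN a _ (hν a _ _)
        rw [cocycleValue_pathClass, e₁, e₂]
        simp [hcm, g]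
      simp only [MonoidHom.comp_apply, MonoidHom.id_apply, h1]
      change cocycleValue hκ' _ = _
      rw [cocycleValue_comp, cocycleValue_comp, cocycleValue_inv, hTm, hTm, hνv]
      simp [g]

end VanKampen

section FreeExtension

open Monoid.Coprod

/-- The free group on a disjoint union is the free product of the free groups. -/
noncomputable def freeGroupSumEquiv (S T : Type*) :
    FreeGroup (S ⊕ T) ≃* Monoid.Coprod (FreeGroup S) (FreeGroup T) :=
  MonoidHom.toMulEquiv
    (FreeGroup.lift (Sum.elim (fun s => inl (FreeGroup.of s)) fun t => inr (FreeGroup.of t)))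
    (Monoid.Coprod.lift (FreeGroup.map Sum.inl) (FreeGroup.map Sum.inr))
    (by
      ext (s | t) <;> simp)
    (by
      refine Monoid.Coprod.hom_ext ?_ ?_ <;> ext <;> simp)

/-- The fundamental groups of `Y` are the free products of those of `U` with a free group
on `S`, whatever the base points. -/
def IsFreeExtension (Y U S : Type*) [TopologicalSpace Y] [TopologicalSpace U] : Prop :=
  ∀ (y : Y) (u : U), Nonempty (FundamentalGroup Y y ≃*
    Monoid.Coprod (FundamentalGroup U u) (FreeGroup S))

variable {Y U V S T : Type*} [TopologicalSpace Y] [TopologicalSpace U] [TopologicalSpace V]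

theorem IsFreeExtension.congr (h : IsFreeExtension Y U S) (e : S ≃ T) : IsFreeExtension Y U T :=
  fun y u => (h y u).map fun φ =>
    φ.trans (MulEquiv.coprodCongr (MulEquiv.refl _) (FreeGroup.freeGroupCongr e))

theorem IsFreeExtension.trans [Nonempty U] (h : IsFreeExtension Y U S)
    (h' : IsFreeExtension U V T) : IsFreeExtension Y V (T ⊕ S) := fun y v => by
  obtain ⟨u⟩ := ‹Nonempty U›
  obtain ⟨φ⟩ := h y u
  obtain ⟨ψ⟩ := h' u v
  exact ⟨φ.trans ((MulEquiv.coprodCongr ψ (MulEquiv.refl _)).trans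
    ((MulEquiv.coprodAssoc _ _ _).trans
      (MulEquiv.coprodCongr (MulEquiv.refl _) (freeGroupSumEquiv T S).symm)))⟩

theorem nonempty_fundamentalGroup_mulEquiv (e : ContinuousMap.HomotopyEquiv Y U) (y : Y) :
    Nonempty (FundamentalGroup Y y ≃* FundamentalGroup U (e y)) := by
  let E := FundamentalGroupoidFunctor.equivOfHomotopyEquiv e
  exact ⟨E.fullyFaithfulFunctor.mulEquivEnd (FundamentalGroupoid.mk y)⟩

theorem nonempty_fundamentalGroup_mulEquiv' [PathConnectedSpace U]
    (e : ContinuousMap.HomotopyEquiv Y U) (y : Y) (u : U) :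
    Nonempty (FundamentalGroup Y y ≃* FundamentalGroup U u) :=
  (nonempty_fundamentalGroup_mulEquiv e y).map fun φ =>
    φ.trans (FundamentalGroup.fundamentalGroupMulEquivOfPathConnected _ _)

theorem pathConnectedSpace_of_homotopyEquiv [PathConnectedSpace U]
    (e : ContinuousMap.HomotopyEquiv Y U) : PathConnectedSpace Y := by
  obtain ⟨F⟩ := e.left_inv
  have hF : ∀ y, Joined (e.invFun (e.toFun y)) y := fun y => ⟨F.evalAt y⟩
  refine ⟨⟨e.invFun (Classical.arbitrary U)⟩, fun x y => (hF x).symm.trans (Joined.trans ?_ (hF y))⟩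
  exact ⟨(PathConnectedSpace.somePath (e.toFun x) (e.toFun y)).map e.invFun.continuous⟩

theorem isFreeExtension_of_homotopyEquiv [PathConnectedSpace U] [IsEmpty S]
    (e : ContinuousMap.HomotopyEquiv Y U) : IsFreeExtension Y U S := fun y u => by
  obtain ⟨φ⟩ := nonempty_fundamentalGroup_mulEquiv' e y u
  let ε : FreeGroup S ≃* PUnit.{1} := MulEquiv.ofUnique
  exact ⟨φ.trans ((MulEquiv.coprodPUnit _).symm.trans
    (MulEquiv.coprodCongr (MulEquiv.refl _) ε.symm))⟩

theorem isFreeExtension_attach {A B : Type*} {Z W : Set Y} {N : A → Set Y}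
    {M : A → Option B → Set Y} (hW : IsOpen W) (hN : ∀ a, IsOpen (N a))
    (hM : ∀ a b, IsOpen (M a b)) (hZ : Z = W ∪ ⋃ a, N a)
    (hNd : Pairwise (Function.onFun Disjoint N))
    (hMd : ∀ a, Pairwise (Function.onFun Disjoint (M a)))
    (hWN : ∀ a, W ∩ N a = ⋃ b, M a b) (hWc : IsPathConnected W)
    (hNs : ∀ a, IsSimplyConnected (N a)) (hMs : ∀ a b, IsSimplyConnected (M a b)) :
    IsPathConnected Z ∧ IsFreeExtension Z W (A × B) := by
  have hWZ : W ⊆ Z := hZ ▸ subset_union_left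
  have hNZ : ∀ a, N a ⊆ Z := fun a => hZ ▸ (subset_iUnion N a).trans subset_union_right
  have hMW : ∀ a b, M a b ⊆ W := fun a b => (subset_iUnion (M a) b).trans
    ((hWN a).symm.subset.trans inter_subset_left)
  have hMN : ∀ a b, M a b ⊆ N a := fun a b => (subset_iUnion (M a) b).trans
    ((hWN a).symm.subset.trans inter_subset_right)
  have hZc : IsPathConnected Z := by
    obtain ⟨w, hw, hwW⟩ := hWc
    refine ⟨w, hWZ hw, ?_⟩
    intro z hz
    rw [hZ] at hz
    rcases hz with hz | hz
    · exact (hwW hz).mono hWZ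
    · obtain ⟨a, ha⟩ := mem_iUnion.1 hz
      obtain ⟨m, hm⟩ := (hMs a none).nonempty
      exact ((hwW (hMW _ _ hm)).mono hWZ).trans
        (((hNs a).isPathConnected.joinedIn m (hMN _ _ hm) z ha).mono (hNZ a))
  refine ⟨hZc, ?_⟩
  have hpre : ∀ s : Set Y, s ⊆ Z → (↑) '' ((↑) ⁻¹' s : Set Z) = s := fun s hs => by
    rw [Subtype.image_preimage_coe, inter_eq_right.2 hs]
  have hsc : ∀ s : Set Y, s ⊆ Z → IsSimplyConnected s → IsSimplyConnected ((↑) ⁻¹' s : Set Z) :=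
    fun s hs h => by rwa [← IsEmbedding.subtypeVal.isSimplyConnected_image, hpre s hs]
  have hc : Continuous ((↑) : Z → Y) := continuous_subtype_val
  have hWc' : IsPathConnected ((↑) ⁻¹' W : Set Z) := by
    rw [IsInducing.subtypeVal.isPathConnected_iff, hpre W hWZ]
    exact hWc
  have : PathConnectedSpace Z := isPathConnected_iff_pathConnectedSpace.1 hZc
  have : PathConnectedSpace W := isPathConnected_iff_pathConnectedSpace.1 hWc
  intro z w
  obtain ⟨φ⟩ := fundamentalGroup_attach (Y := Z) (U := Subtype.val ⁻¹' W)
    (N := fun a => (↑) ⁻¹' N a)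
    (M := fun a b => (↑) ⁻¹' M a b) (hW.preimage hc) (fun a => (hN a).preimage hc)
    (fun a b => (hM a b).preimage hc)
    (fun y => by
      simpa using hZ.subset y.2)
    (fun a a' h => (hNd h).preimage _) (fun a b b' h => (hMd a h).preimage _)
    (fun a => by rw [← preimage_inter, hWN, preimage_iUnion]) hWc'
    (fun a => hsc _ (hNZ a) (hNs a))
    (fun a b => hsc _ ((hMN a b).trans (hNZ a)) (hMs a b)) ⟨⟨w, hWZ w.2⟩, w.2⟩
  let ε : ((↑) ⁻¹' W : Set Z) ≃ₜ W :=
    { toFun := fun x => ⟨x, x.2⟩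
      invFun := fun x => ⟨⟨x, hWZ x.2⟩, x.2⟩
      left_inv := fun _ => rfl
      right_inv := fun _ => rfl
      continuous_toFun := by fun_prop
      continuous_invFun := by fun_prop }
  obtain ⟨ψ⟩ := nonempty_fundamentalGroup_mulEquiv' ε.toHomotopyEquiv ⟨⟨w, hWZ w.2⟩, w.2⟩ w
  exact ⟨(FundamentalGroup.fundamentalGroupMulEquivOfPathConnected _ _).trans
    (φ.trans (MulEquiv.coprodCongr ψ (MulEquiv.refl _)))⟩

end FreeExtension

section UConf

variable {X : Type*} [TopologicalSpace X] {n : ℕ}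

/-- The unordered configuration underlying an ordered one. -/
def uconfMk (a : {a : Fin n → X // Function.Injective a}) : UConf n X := Quot.mk _ a

theorem uconfMk_eq_iff {a b : {a : Fin n → X // Function.Injective a}} :
    uconfMk a = uconfMk b ↔ ∃ e : Equiv.Perm (Fin n), (a : Fin n → X) ∘ e = b := by
  refine ⟨fun h => ?_, fun h => Quot.sound h⟩
  have he : Equivalence (permRel n X) := by
    refine ⟨fun a => ⟨1, rfl⟩, ?_, ?_⟩
    · rintro a b ⟨e, h⟩
      refine ⟨e⁻¹, ?_⟩
      rw [← h]
      ext i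
      simp
    · rintro a b c ⟨e, h⟩ ⟨τ, h'⟩
      refine ⟨e * τ, ?_⟩
      rw [← h', ← h]
      rfl
  exact he.quot_mk_eq_iff a b |>.1 h

theorem uconfMk_comp (a : {a : Fin n → X // Function.Injective a}) (e : Equiv.Perm (Fin n)) :
    uconfMk ⟨a.1 ∘ e, a.2.comp e.injective⟩ = uconfMk a :=
  (uconfMk_eq_iff.2 ⟨e, rfl⟩).symm

theorem isOpenQuotientMap_uconfMk : IsOpenQuotientMap (uconfMk : _ → UConf n X) := by
  refine ⟨Quot.mk_surjective, continuous_quot_mk, fun O hO => ?_⟩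
  have hq : IsQuotientMap (uconfMk : _ → UConf n X) := isQuotientMap_quot_mk
  rw [← hq.isOpen_preimage]
  have : uconfMk ⁻¹' (uconfMk '' O) = ⋃ e : Equiv.Perm (Fin n),
      (fun a : {a : Fin n → X // Function.Injective a} =>
        (⟨a.1 ∘ e, a.2.comp e.injective⟩ : {a : Fin n → X // Function.Injective a})) ⁻¹' O := by
    ext a
    simp only [mem_preimage, mem_image, mem_iUnion]
    constructor
    · rintro ⟨b, hb, h⟩
      obtain ⟨e, he⟩ := uconfMk_eq_iff.1 h.symm
      exact ⟨e, by convert hb⟩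
    · rintro ⟨e, he⟩
      exact ⟨_, he, uconfMk_comp a e⟩
  rw [this]
  refine isOpen_iUnion fun e => hO.preimage ?_
  refine Continuous.subtype_mk (continuous_pi fun i => ?_) _
  exact (continuous_apply (e i)).comp continuous_subtype_val

variable {f : X → ℝ}

theorem exists_monotone_uconfMk (f : X → ℝ) (u : UConf n X) :
    ∃ a : {a : Fin n → X // Function.Injective a}, Monotone (f ∘ a.1) ∧ uconfMk a = u := by
  obtain ⟨a, rfl⟩ := isOpenQuotientMap_uconfMk.surjective u
  exact ⟨⟨a.1 ∘ _, _⟩, Tuple.monotone_sort (f ∘ a.1), uconfMk_comp a _⟩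

/-- The configurations in which all but the `k` lowest points have positive height. -/
def aboveSet (f : X → ℝ) (k : Fin n) : Set (UConf n X) :=
  uconfMk '' {a | ∀ i, k ≤ i → 0 < f (a.1 i)}

theorem isOpen_aboveSet (hf : Continuous f) (k : Fin n) : IsOpen (aboveSet f k) := by
  refine isOpenQuotientMap_uconfMk.isOpenMap _ ?_
  simp only [ofPred_forall]
  refine isOpen_iInter_of_finite fun i => isOpen_iInter_of_finite fun _ => ?_
  exact isOpen_lt continuous_const (hf.comp ((continuous_apply i).comp continuous_subtype_val))

theorem mem_aboveSet_iff {a : {a : Fin n → X // Function.Injective a}} (ha : Monotone (f ∘ a.1))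
    (k : Fin n) : uconfMk a ∈ aboveSet f k ↔ 0 < f (a.1 k) := by
  constructor
  · rintro ⟨b, hb, h⟩
    obtain ⟨e, he⟩ := uconfMk_eq_iff.1 h.symm
    by_contra hk
    have h1 : ∀ i ∈ Finset.Ici k, e i ∈ Finset.Ioi k := by
      intro i hi
      rw [Finset.mem_Ici] at hi
      rw [Finset.mem_Ioi]
      by_contra hlt
      have h2 := hb i hi
      rw [← he] at h2
      exact hk (h2.trans_le (ha (not_lt.1 hlt)))
    have h2 := Finset.card_le_card_of_injOn e h1 e.injective.injOn
    rw [Fin.card_Ici, Fin.card_Ioi] at h2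
    omega
  · exact fun h => ⟨a, fun i hi => h.trans_le (ha hi), rfl⟩

/-- The configurations with points of distinct heights lying, in order of height, in the
given sets. -/
def heightCell (f : X → ℝ) (D : Fin n → Set X) : Set (UConf n X) :=
  uconfMk '' {a | (∀ i, a.1 i ∈ D i) ∧ StrictMono (f ∘ a.1)}

theorem mem_heightCell_iff {a : {a : Fin n → X // Function.Injective a}}
    (ha : Monotone (f ∘ a.1)) {D : Fin n → Set X} :
    uconfMk a ∈ heightCell f D ↔ (∀ i, a.1 i ∈ D i) ∧ StrictMono (f ∘ a.1) := by
  constructor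
  · rintro ⟨b, hb, h⟩
    obtain ⟨e, he⟩ := uconfMk_eq_iff.1 h
    have h1 : (f ∘ b.1) ∘ e = (f ∘ b.1) ∘ (1 : Equiv.Perm (Fin n)) := by
      refine Tuple.unique_monotone ?_ hb.2.monotone
      rw [Function.comp_assoc, he]
      exact ha
    have h2 : e = 1 := Equiv.ext fun i => hb.2.injective (congrFun h1 i)
    have h3 : b = a := Subtype.ext (by rw [← he, h2]; rfl)
    exact h3 ▸ hb
  · exact fun h => ⟨a, h, rfl⟩

theorem heightCell_disjoint {D D' : Fin n → Set X} (i : Fin n) (h : Disjoint (D i) (D' i)) :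
    Disjoint (heightCell f D) (heightCell f D') := by
  rw [disjoint_left]
  intro u hu hu'
  obtain ⟨a, ha, rfl⟩ := exists_monotone_uconfMk f u
  rw [mem_heightCell_iff ha] at hu hu'
  exact disjoint_left.1 h (hu.1 i) (hu'.1 i)

theorem isOpen_setOf_strictMono_height (hf : Continuous f) {D : Fin n → Set X}
    (hD : ∀ i, IsOpen (D i)) :
    IsOpen {a : {a : Fin n → X // Function.Injective a} |
      (∀ i, a.1 i ∈ D i) ∧ StrictMono (f ∘ a.1)} := by
  simp only [StrictMono, ofPred_and, ofPred_forall]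
  refine IsOpen.inter (isOpen_iInter_of_finite fun i => ?_) (isOpen_iInter_of_finite fun i =>
    isOpen_iInter_of_finite fun j => isOpen_iInter_of_finite fun _ => ?_)
  · exact (hD i).preimage ((continuous_apply i).comp continuous_subtype_val)
  · exact isOpen_lt (hf.comp ((continuous_apply i).comp continuous_subtype_val))
      (hf.comp ((continuous_apply j).comp continuous_subtype_val))

theorem isOpen_heightCell (hf : Continuous f) {D : Fin n → Set X} (hD : ∀ i, IsOpen (D i)) :
    IsOpen (heightCell f D) :=
  isOpenQuotientMap_uconfMk.isOpenMap _ (isOpen_setOf_strictMono_height hf hD)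

/-- `D` contracts within itself to a point of height `c`, all heights moving linearly. -/
def HeightContractible (f : X → ℝ) (D : Set X) (c : ℝ) : Prop :=
  ∃ (x₀ : D) (h : C(I × D, D)), (∀ x, h (0, x) = x) ∧ (∀ x, h (1, x) = x₀) ∧
    ∀ s x, f (h (s, x)) = (1 - s) * f x + s * c

theorem isSimplyConnected_heightCell (hf : Continuous f) {D : Fin n → Set X}
    (hD : ∀ i, IsOpen (D i)) {c : Fin n → ℝ} (hc : StrictMono c)
    (h : ∀ i, HeightContractible f (D i) (c i)) : IsSimplyConnected (heightCell f D) := by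
  choose x₀ h h0 h1 hh using h
  let O : Set {a : Fin n → X // Function.Injective a} :=
    {a | (∀ i, a.1 i ∈ D i) ∧ StrictMono (f ∘ a.1)}
  have hO : IsOpen O := isOpen_setOf_strictMono_height hf hD
  let e : O → UConf n X := fun a => uconfMk a.1
  have he : IsOpenEmbedding e := by
    refine IsOpenEmbedding.of_continuous_injective_isOpenMap
      (isOpenQuotientMap_uconfMk.continuous.comp continuous_subtype_val) ?_
      (isOpenQuotientMap_uconfMk.isOpenMap.comp hO.isOpenMap_subtype_val)
    rintro ⟨a, ha⟩ ⟨b, hb⟩ hab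
    obtain ⟨τ, hτ⟩ := uconfMk_eq_iff.1 hab
    have h1 : (f ∘ a.1) ∘ τ = (f ∘ a.1) ∘ (1 : Equiv.Perm (Fin n)) := by
      refine Tuple.unique_monotone ?_ ha.2.monotone
      rw [Function.comp_assoc, hτ]
      exact hb.2.monotone
    have h2 : τ = 1 := Equiv.ext fun i => ha.2.injective (congrFun h1 i)
    exact Subtype.ext (Subtype.ext (by rw [← hτ, h2]; rfl))
  have hr : heightCell f D = range e := by
    rw [heightCell, image_eq_range]
  have hOm : ∀ (s : I) (a : O),
      StrictMono (f ∘ fun i => (h i (s, ⟨a.1.1 i, a.2.1 i⟩) : X)) := by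
    intro s a i j hij
    have h2 : f (a.1.1 i) < f (a.1.1 j) := a.2.2 hij
    have h3 := hc hij
    simp only [Function.comp_apply, hh]
    nlinarith [s.2.1, s.2.2, mul_nonneg s.2.1 (sub_nonneg.2 h3.le),
      mul_nonneg (sub_nonneg.2 s.2.2) (sub_nonneg.2 h2.le)]
  have hOc : ContractibleSpace O := by
    let p : O := ⟨⟨fun i => x₀ i, fun i j hij => by
      have h2 : ∀ i, f (x₀ i) = c i := fun i => by
        have := hh i 1 (x₀ i)
        rw [h1] at this
        simpa using this
      exact hc.injective (by rw [← h2, ← h2]; exact congrArg f hij)⟩, fun i => (x₀ i).2, by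
      intro i j hij
      have h2 : ∀ i, f (x₀ i) = c i := fun i => by
        have := hh i 1 (x₀ i)
        rw [h1] at this
        simpa using this
      simpa [h2] using hc hij⟩
    rw [contractible_iff_id_nullhomotopic]
    refine ⟨p, ⟨⟨⟨fun sa => ⟨⟨fun i => h i (sa.1, ⟨sa.2.1.1 i, sa.2.2.1 i⟩),
      fun i j hij => (hOm sa.1 sa.2).injective (congrArg f hij)⟩, fun i => (h i _).2,
      hOm sa.1 sa.2⟩, ?_⟩, ?_, ?_⟩⟩⟩
    · refine Continuous.subtype_mk (Continuous.subtype_mk (continuous_pi fun i => ?_) _) _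
      refine continuous_subtype_val.comp ((h i).continuous.comp
        (continuous_fst.prodMk (Continuous.subtype_mk ?_ _)))
      exact (continuous_apply i).comp (continuous_subtype_val.comp
        (continuous_subtype_val.comp continuous_snd))
    · intro a
      ext i
      simp [h0]
    · intro a
      ext i
      simp [h1, p]
  have : ContractibleSpace (range e) := he.isEmbedding.toHomeomorph.symm.contractibleSpace
  rw [hr, IsSimplyConnected]
  infer_instance

end UConf

section Retraction

variable {X G : Type*} [TopologicalSpace X] [TopologicalSpace G] {f : X → ℝ}

theorem mem_aboveSet_one_iff {n : ℕ} {a : {a : Fin (n + 2) → X // Function.Injective a}} :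
    uconfMk a ∈ aboveSet f 1 ↔ ∀ i j, i ≠ j → 0 < f (a.1 i) ∨ 0 < f (a.1 j) := by
  constructor
  · rintro ⟨b, hb, h⟩ i j hij
    obtain ⟨e, he⟩ := uconfMk_eq_iff.1 h
    have hpos : ∀ i, e i ≠ 0 → 0 < f (a.1 i) := fun i hi => by
      rw [← he]
      exact hb _ (Fin.one_le_of_ne_zero hi)
    by_cases hi : e i = 0
    · exact Or.inr (hpos j fun hj => hij (e.injective (hi.trans hj.symm)))
    · exact Or.inl (hpos i hi)
  · intro h
    obtain ⟨b, hb, e⟩ := exists_monotone_uconfMk f (uconfMk a)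
    rw [← e, mem_aboveSet_iff hb]
    obtain ⟨τ, hτ⟩ := uconfMk_eq_iff.1 e.symm
    have := h (τ 0) (τ 1) (fun h => by simpa using τ.injective h)
    rw [show a.1 (τ 0) = b.1 0 from congrFun hτ 0,
      show a.1 (τ 1) = b.1 1 from congrFun hτ 1] at this
    exact this.elim (fun h => h.trans_le (hb (Fin.zero_le _))) id

/-- A deformation of `X` onto the points of nonnegative height, moving heights linearly. -/
structure HeightRetraction (f : X → ℝ) (ρ : C(I × X, X)) : Prop where
  zero : ∀ x, ρ (0, x) = x
  of_nonneg : ∀ s x, 0 ≤ f x → ρ (s, x) = x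
  of_nonpos : ∀ s x, f x ≤ 0 → f (ρ (s, x)) = (1 - s) * f x

variable {ρ : C(I × X, X)}

theorem HeightRetraction.nonneg (hρ : HeightRetraction f ρ) (x : X) : 0 ≤ f (ρ (1, x)) := by
  rcases le_total 0 (f x) with h | h
  · rwa [hρ.of_nonneg 1 x h]
  · rw [hρ.of_nonpos 1 x h]
    simp

theorem HeightRetraction.nonpos (hρ : HeightRetraction f ρ) (s : I) {x : X} (h : f x ≤ 0) :
    f (ρ (s, x)) ≤ 0 := by
  rw [hρ.of_nonpos s x h]
  exact mul_nonpos_of_nonneg_of_nonpos (sub_nonneg.2 s.2.2) h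

theorem HeightRetraction.pos_iff (hρ : HeightRetraction f ρ) (s : I) {x : X} :
    0 < f (ρ (s, x)) ↔ 0 < f x := by
  rcases lt_or_ge 0 (f x) with h | h
  · rw [hρ.of_nonneg s x h.le]
  · exact iff_of_false (hρ.nonpos s h).not_gt h.not_gt

theorem HeightRetraction.injective (hρ : HeightRetraction f ρ) (s : I) {n : ℕ}
    {a : {a : Fin (n + 2) → X // Function.Injective a}} (ha : uconfMk a ∈ aboveSet f 1) :
    Function.Injective fun i => ρ (s, a.1 i) := by
  intro i j hij
  by_contra hne
  have h : 0 < f (a.1 i) ∧ 0 < f (a.1 j) := by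
    have hiff : 0 < f (a.1 i) ↔ 0 < f (a.1 j) := by
      rw [← hρ.pos_iff s, ← hρ.pos_iff s (x := a.1 j)]
      exact iff_of_eq (congrArg (fun x => 0 < f x) hij)
    have := mem_aboveSet_one_iff.1 ha i j hne
    tauto
  simp only [hρ.of_nonneg s _ h.1.le, hρ.of_nonneg s _ h.2.le] at hij
  exact hne (a.2 hij)

/-- The configurations with at most one point of nonpositive height deform to the
configurations of points of nonnegative height. -/
theorem HeightRetraction.homotopyEquiv (hρ : HeightRetraction f ρ)
    (hinj : InjOn f {x | f x ≤ 0}) {i : G → X} (hi : IsEmbedding i)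
    (hr : range i = {x | 0 ≤ f x}) (n : ℕ) :
    Nonempty (ContinuousMap.HomotopyEquiv (aboveSet f (1 : Fin (n + 2))) (UConf (n + 2) G)) := by
  let W : Set (UConf (n + 2) X) := aboveSet f 1
  have hpos : ∀ g, 0 ≤ f (i g) := fun g => hr.subset ⟨g, rfl⟩
  obtain ⟨k, hk⟩ : ∃ k : C(X, G), ∀ x, i (k x) = ρ (1, x) := by
    have hm : ∀ x, ρ (1, x) ∈ range i := fun x => hr ▸ hρ.nonneg x
    choose k hk using hm
    exact ⟨⟨k, hi.continuous_iff.2 (by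
      rw [show i ∘ k = fun x => ρ (1, x) from funext hk]; fun_prop)⟩, hk⟩
  have hki : ∀ g, k (i g) = g := fun g => hi.injective (by
    rw [hk, hρ.of_nonneg _ _ (hpos g)])
  have hQ := isOpenQuotientMap_uconfMk (X := X) (n := n + 2) |>.restrictPreimage W
  have hQ' := (IsOpenQuotientMap.id (X := I)).prodMap hQ
  have hQG := isOpenQuotientMap_uconfMk (X := G) (n := n + 2)
  have hmem : ∀ s (a : uconfMk ⁻¹' W), uconfMk ⟨_, hρ.injective s a.2⟩ ∈ W := by
    intro s a
    have := mem_aboveSet_one_iff.1 a.2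
    refine mem_aboveSet_one_iff.2 fun j l hjl => ?_
    simp only [hρ.pos_iff s]
    exact this j l hjl
  have hinjk : ∀ a : uconfMk ⁻¹' W, Function.Injective fun j => k (a.1.1 j) := fun a j l h =>
    hρ.injective 1 a.2 (by simpa [hk] using congrArg i h)
  have hiW : ∀ a : {a : Fin (n + 2) → G // Function.Injective a},
      uconfMk ⟨i ∘ a.1, hi.injective.comp a.2⟩ ∈ W := by
    intro a
    refine mem_aboveSet_one_iff.2 fun j l hjl => ?_
    by_contra hlt
    push Not at hlt
    refine hjl (a.2 (hi.injective (hinj hlt.1 hlt.2 ?_)))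
    exact (le_antisymm hlt.1 (hpos _)).trans (le_antisymm hlt.2 (hpos _)).symm
  -- the three maps, on ordered configurations
  let H₀ : C(I × (uconfMk ⁻¹' W : Set _), W) :=
    ⟨fun sa => ⟨uconfMk ⟨_, hρ.injective sa.1 sa.2.2⟩, hmem sa.1 sa.2⟩, by
      refine Continuous.subtype_mk (isOpenQuotientMap_uconfMk.continuous.comp
        (Continuous.subtype_mk (continuous_pi fun j => ρ.continuous.comp
          (continuous_fst.prodMk ?_)) _)) _
      exact (continuous_apply j).comp (continuous_subtype_val.comp
        (continuous_subtype_val.comp continuous_snd))⟩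
  let K₀ : C((uconfMk ⁻¹' W : Set _), UConf (n + 2) G) :=
    ⟨fun a => uconfMk ⟨_, hinjk a⟩, by
      refine hQG.continuous.comp (Continuous.subtype_mk (continuous_pi fun j =>
        k.continuous.comp ?_) _)
      exact (continuous_apply j).comp (continuous_subtype_val.comp continuous_subtype_val)⟩
  let J₀ : C({a : Fin (n + 2) → G // Function.Injective a}, W) :=
    ⟨fun a => ⟨_, hiW a⟩, by
      refine Continuous.subtype_mk (isOpenQuotientMap_uconfMk.continuous.comp
        (Continuous.subtype_mk (continuous_pi fun j => hi.continuous.comp ?_) _)) _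
      exact (continuous_apply j).comp continuous_subtype_val⟩
  let q : C((uconfMk ⁻¹' W : Set _), W) := ⟨_, hQ.continuous⟩
  let q' : C(I × (uconfMk ⁻¹' W : Set _), I × W) := ⟨_, hQ'.continuous⟩
  let qG : C({a : Fin (n + 2) → G // Function.Injective a}, UConf (n + 2) G) := ⟨_, hQG.continuous⟩
  have hq : IsQuotientMap q := hQ.isQuotientMap
  have hq' : IsQuotientMap q' := hQ'.isQuotientMap
  have hqG : IsQuotientMap qG := hQG.isQuotientMap
  have fH : Function.FactorsThrough H₀ q' := by
    rintro ⟨s, a⟩ ⟨s', b⟩ h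
    obtain rfl : s = s' := congrArg Prod.fst h
    obtain ⟨e, he⟩ := uconfMk_eq_iff.1 (congrArg (fun x => x.2.1) h)
    refine Subtype.ext (uconfMk_eq_iff.2 ⟨e, funext fun j => ?_⟩)
    exact congrArg (fun x => ρ (s, x)) (congrFun he j)
  have fK : Function.FactorsThrough K₀ q := by
    intro a b h
    obtain ⟨e, he⟩ := uconfMk_eq_iff.1 (congrArg Subtype.val h)
    exact uconfMk_eq_iff.2 ⟨e, funext fun j => congrArg k (congrFun he j)⟩
  have fJ : Function.FactorsThrough J₀ qG := by
    intro a b h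
    obtain ⟨e, he⟩ := uconfMk_eq_iff.1 h
    exact Subtype.ext (uconfMk_eq_iff.2 ⟨e, funext fun j => congrArg i (congrFun he j)⟩)
  let H := hq'.lift H₀ fH
  let K := hq.lift K₀ fK
  let J := hqG.lift J₀ fJ
  have hH : ∀ s a, H (s, q a) = H₀ (s, a) := fun s a =>
    DFunLike.congr_fun (hq'.lift_comp H₀ fH) (s, a)
  have hK : ∀ a, K (q a) = K₀ a := DFunLike.congr_fun (hq.lift_comp K₀ fK)
  have hJ : ∀ a, J (qG a) = J₀ a := DFunLike.congr_fun (hqG.lift_comp J₀ fJ)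
  refine ⟨⟨K, J, ?_, ?_⟩⟩
  · refine ContinuousMap.Homotopic.symm ⟨⟨H, ?_, ?_⟩⟩
    · intro w
      obtain ⟨a, rfl⟩ := hQ.surjective w
      refine (hH 0 a).trans (Subtype.ext (congrArg uconfMk (Subtype.ext (funext fun j => ?_))))
      exact hρ.zero _
    · intro w
      obtain ⟨a, rfl⟩ := hQ.surjective w
      refine (hH 1 a).trans ?_
      change _ = J (K (q a))
      rw [hK]
      refine Eq.trans ?_ (hJ _).symm
      refine Subtype.ext (congrArg uconfMk (Subtype.ext (funext fun j => ?_)))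
      exact (hk _).symm
  · have : K.comp J = ContinuousMap.id _ := by
      ext u
      obtain ⟨a, rfl⟩ := hQG.surjective u
      change K (J (qG a)) = _
      rw [hJ]
      have e : J₀ a = q ⟨_, hiW a⟩ := rfl
      rw [e, hK]
      exact congrArg uconfMk (Subtype.ext (funext fun j => hki _))
    rw [this]

end Retraction

section RayAttachment

variable {X G : Type*} [TopologicalSpace X] [TopologicalSpace G] {f : X → ℝ}

/-- A height function on a space `X` obtained from `G` by attaching a ray: `G` is the part of
nonnegative height, the positive part has the components `C a`, and the part of height strictly
between `0` and `1` has the components `E b`. -/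
structure RayHeight (f : X → ℝ) (i : G → X) {A B : Type*} (C : A → Set X)
    (E : Option B → Set X) : Prop where
  continuous : Continuous f
  injOn : InjOn f {x | f x ≤ 0}
  isEmbedding : IsEmbedding i
  range_eq : range i = {x | 0 ≤ f x}
  retraction : ∃ ρ, HeightRetraction f ρ
  isOpen_C : ∀ a, IsOpen (C a)
  disjoint_C : Pairwise (Function.onFun Disjoint C)
  iUnion_C : ⋃ a, C a = {x | 0 < f x}
  contractible_C : ∀ a, HeightContractible f (C a) 1
  isOpen_E : ∀ b, IsOpen (E b)
  disjoint_E : Pairwise (Function.onFun Disjoint E)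
  iUnion_E : ⋃ b, E b = {x | 0 < f x ∧ f x < 1}
  contractible_E : ∀ b, HeightContractible f (E b) (1 / 2)
  contractible_neg : ∀ c, -1 ≤ c → c < 0 → HeightContractible f {x | f x < 0} c
  contractible_lt_one : HeightContractible f {x | f x < 1} 0

variable {i : G → X} {A B : Type*} {C : A → Set X} {E : Option B → Set X}

theorem monotone_three_iff {g : Fin 3 → ℝ} : Monotone g ↔ g 0 ≤ g 1 ∧ g 1 ≤ g 2 := by
  rw [Fin.monotone_iff_le_succ, Fin.forall_fin_two]
  rfl

theorem strictMono_three_iff {g : Fin 3 → ℝ} : StrictMono g ↔ g 0 < g 1 ∧ g 1 < g 2 := by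
  rw [Fin.strictMono_iff_lt_succ, Fin.forall_fin_two]
  rfl

theorem RayHeight.isFreeExtension (h : RayHeight f i C E) (hG : PathConnectedSpace (UConf 3 G)) :
    PathConnectedSpace (UConf 3 X) ∧
      IsFreeExtension (UConf 3 X) (UConf 3 G) ((Empty ⊕ (A × B)) ⊕ (Unit × B)) := by
  obtain ⟨ρ, hρ⟩ := h.retraction
  obtain ⟨e⟩ := hρ.homotopyEquiv h.injOn h.isEmbedding h.range_eq 1
  have hf := h.continuous
  have hneg : IsOpen {x | f x < 0} := isOpen_lt hf continuous_const
  have hlt : IsOpen {x | f x < 1} := isOpen_lt hf continuous_const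
  have hCpos : ∀ {a x}, x ∈ C a → 0 < f x := fun hx => h.iUnion_C.subset (mem_iUnion.2 ⟨_, hx⟩)
  have hEpos : ∀ {b x}, x ∈ E b → 0 < f x ∧ f x < 1 :=
    fun hx => h.iUnion_E.subset (mem_iUnion.2 ⟨_, hx⟩)
  have hlt_of : ∀ {x y}, x ≠ y → f x ≤ f y → f y ≤ 0 → f x < f y := fun hne hle h0 =>
    hle.lt_of_ne fun he => hne (h.injOn (hle.trans h0) h0 he)
  have hW₁c : IsPathConnected (aboveSet f (1 : Fin 3)) := by
    have : PathConnectedSpace (aboveSet f (1 : Fin 3)) :=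
      pathConnectedSpace_of_homotopyEquiv e
    exact isPathConnected_iff_pathConnectedSpace.2 this
  have hAboveTwo := isFreeExtension_attach (Z := aboveSet f (2 : Fin 3))
    (W := aboveSet f (1 : Fin 3))
    (N := fun a => heightCell f ![{x | f x < 0}, {x | f x < 1}, C a])
    (M := fun a b => heightCell f ![{x | f x < 0}, E b, C a])
    (isOpen_aboveSet hf 1)
    (fun a => isOpen_heightCell hf (by simp [Fin.forall_fin_succ, hneg, hlt, h.isOpen_C a]))
    (fun a b => isOpen_heightCell hf
      (by simp [Fin.forall_fin_succ, hneg, h.isOpen_E b, h.isOpen_C a]))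
    (by
      ext u
      obtain ⟨a, ha, rfl⟩ := exists_monotone_uconfMk f u
      simp only [mem_union, mem_iUnion, mem_aboveSet_iff ha, mem_heightCell_iff ha,
        strictMono_three_iff, Fin.forall_fin_succ, Function.comp_apply]
      rw [monotone_three_iff] at ha
      simp only [Function.comp_apply] at ha
      constructor
      · intro h2
        refine or_iff_not_imp_left.2 fun h1 => ?_
        obtain ⟨c, hc⟩ := mem_iUnion.1 (h.iUnion_C.symm.subset h2)
        have h01 := hlt_of (a.2.ne (by decide)) ha.1 (not_lt.1 h1)
        exact ⟨c, ⟨h01.trans_le (not_lt.1 h1), (not_lt.1 h1).trans_lt one_pos, hc, nofun⟩, h01,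
          (not_lt.1 h1).trans_lt h2⟩
      · rintro (h1 | ⟨c, hc, -⟩)
        · exact h1.trans_le ha.2
        · exact hCpos hc.2.2.1)
    (fun a a' haa' => heightCell_disjoint 2 (h.disjoint_C haa'))
    (fun a b b' hbb' => heightCell_disjoint 1 (h.disjoint_E hbb'))
    (fun c => by
      ext u
      obtain ⟨a, ha, rfl⟩ := exists_monotone_uconfMk f u
      simp only [mem_inter_iff, mem_iUnion, mem_aboveSet_iff ha, mem_heightCell_iff ha,
        strictMono_three_iff, Fin.forall_fin_succ, Function.comp_apply]
      constructor
      · rintro ⟨h1, hD, hs⟩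
        obtain ⟨b, hb⟩ := mem_iUnion.1 (h.iUnion_E.symm.subset ⟨h1, hD.2.1⟩)
        exact ⟨b, ⟨hD.1, hb, hD.2.2⟩, hs⟩
      · rintro ⟨b, hD, hs⟩
        exact ⟨(hEpos hD.2.1).1, ⟨hD.1, (hEpos hD.2.1).2, hD.2.2⟩, hs⟩)
    hW₁c
    (fun a => isSimplyConnected_heightCell hf (c := ![-1, 0, 1])
      (by simp [Fin.forall_fin_succ, hneg, hlt, h.isOpen_C a])
      (by simp)
      (by
        simp [Fin.forall_fin_succ, h.contractible_neg, h.contractible_lt_one, h.contractible_C]))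
    (fun a b => isSimplyConnected_heightCell hf (c := ![-1, 1 / 2, 1])
      (by simp [Fin.forall_fin_succ, hneg, h.isOpen_E b, h.isOpen_C a])
      (by simp; norm_num)
      (by
        have := h.contractible_E b
        simp_all [Fin.forall_fin_succ, h.contractible_neg, h.contractible_C]))
  have hUniv := isFreeExtension_attach (Z := univ) (W := aboveSet f (2 : Fin 3))
    (N := fun _ : Unit => heightCell f ![{x | f x < 0}, {x | f x < 0}, {x | f x < 1}])
    (M := fun _ b => heightCell f ![{x | f x < 0}, {x | f x < 0}, E b])
    (isOpen_aboveSet hf 2)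
    (fun _ => isOpen_heightCell hf (by simp [Fin.forall_fin_succ, hneg, hlt]))
    (fun _ b => isOpen_heightCell hf (by simp [Fin.forall_fin_succ, hneg, h.isOpen_E b]))
    (by
      ext u
      obtain ⟨a, ha, rfl⟩ := exists_monotone_uconfMk f u
      simp only [mem_union, mem_iUnion, mem_aboveSet_iff ha, mem_heightCell_iff ha,
        strictMono_three_iff, Fin.forall_fin_succ, Function.comp_apply, mem_univ, true_iff]
      rw [monotone_three_iff] at ha
      simp only [Function.comp_apply] at ha
      refine or_iff_not_imp_left.2 fun h2 => ?_
      have h2' := not_lt.1 h2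
      have h12 := hlt_of (a.2.ne (by decide)) ha.2 h2'
      have h01 := hlt_of (a.2.ne (by decide)) ha.1 (h12.le.trans h2')
      exact ⟨(), ⟨h01.trans (h12.trans_le h2'), h12.trans_le h2', h2'.trans_lt one_pos, nofun⟩,
        h01, h12⟩)
    (fun a a' haa' => (haa' rfl).elim)
    (fun _ b b' hbb' => heightCell_disjoint 2 (h.disjoint_E hbb'))
    (fun _ => by
      ext u
      obtain ⟨a, ha, rfl⟩ := exists_monotone_uconfMk f u
      simp only [mem_inter_iff, mem_iUnion, mem_aboveSet_iff ha, mem_heightCell_iff ha,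
        strictMono_three_iff, Fin.forall_fin_succ, Function.comp_apply]
      constructor
      · rintro ⟨h1, hD, hs⟩
        obtain ⟨b, hb⟩ := mem_iUnion.1 (h.iUnion_E.symm.subset ⟨h1, hD.2.2.1⟩)
        exact ⟨b, ⟨hD.1, hD.2.1, hb, nofun⟩, hs⟩
      · rintro ⟨b, hD, hs⟩
        exact ⟨(hEpos hD.2.2.1).1, ⟨hD.1, hD.2.1, (hEpos hD.2.2.1).2, nofun⟩, hs⟩)
    hAboveTwo.1
    (fun _ => isSimplyConnected_heightCell hf (c := ![-1, -1 / 2, 0])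
      (by simp [Fin.forall_fin_succ, hneg, hlt])
      (by simp; norm_num)
      (by
        have := h.contractible_neg (-1 / 2) (by norm_num) (by norm_num)
        simp_all [Fin.forall_fin_succ, h.contractible_neg, h.contractible_lt_one]))
    (fun _ b => isSimplyConnected_heightCell hf (c := ![-1, -1 / 2, 1 / 2])
      (by simp [Fin.forall_fin_succ, hneg, h.isOpen_E b])
      (by simp; norm_num)
      (by
        have := h.contractible_E b
        have := h.contractible_neg (-1 / 2) (by norm_num) (by norm_num)
        simp_all [Fin.forall_fin_succ, h.contractible_neg]))
  have hX : PathConnectedSpace (UConf 3 X) := pathConnectedSpace_iff_univ.2 hUniv.1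
  have : PathConnectedSpace (aboveSet f (2 : Fin 3)) :=
    isPathConnected_iff_pathConnectedSpace.1 hAboveTwo.1
  have : PathConnectedSpace (univ : Set (UConf 3 X)) :=
    isPathConnected_iff_pathConnectedSpace.1 hUniv.1
  have : PathConnectedSpace (aboveSet f (1 : Fin 3)) :=
    isPathConnected_iff_pathConnectedSpace.1 hW₁c
  refine ⟨hX, ?_⟩
  have e₀ : IsFreeExtension (aboveSet f (1 : Fin 3)) (UConf 3 G) Empty :=
    isFreeExtension_of_homotopyEquiv e
  have e₃ : IsFreeExtension (UConf 3 X) (univ : Set (UConf 3 X)) Empty :=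
    isFreeExtension_of_homotopyEquiv (Homeomorph.Set.univ _).symm.toHomotopyEquiv
  exact (e₃.trans (hUniv.2.trans (hAboveTwo.2.trans e₀))).congr (Equiv.sumEmpty _ _)

end RayAttachment

section Arcs

/-- The roles of the arcs of a pulsar: an arc from `p` to `q`, a ray at `p`, a ray at `q`, or
the ray at `p` that is being attached. -/
inductive ArcKind
  | leg
  | pRay
  | qRay
  | newRay

/-- The height of the point with parameter `t` of an arc. -/
def ArcKind.height : ArcKind → I → ℝ
  | leg, t => t
  | pRay, t => t
  | qRay, _ => 1
  | newRay, t => -t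

/-- The parameters at which an arc passes through `p`. -/
def ArcKind.IsPEnd : ArcKind → I → Prop
  | leg, t => t = 0
  | pRay, t => t = 0
  | qRay, _ => False
  | newRay, t => t = 0

/-- The parameters at which an arc passes through `q`. -/
def ArcKind.IsQEnd : ArcKind → I → Prop
  | leg, t => t = 1
  | pRay, _ => False
  | qRay, t => t = 0
  | newRay, _ => False

/-- Linear interpolation in the unit interval. -/
def unitMix (s t u : I) : I :=
  ⟨(1 - s) * t + s * u, (convex_Icc (0 : ℝ) 1) t.2 u.2 (sub_nonneg.2 s.2.2) s.2.1 (by ring)⟩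

theorem coe_unitMix (s t u : I) : (unitMix s t u : ℝ) = (1 - s) * t + s * u := rfl

theorem continuous_unitMix : Continuous fun x : I × I × I => unitMix x.1 x.2.1 x.2.2 := by
  unfold unitMix
  fun_prop

@[simp] theorem unitMix_self (s t : I) : unitMix s t t = t := Subtype.ext (by
  rw [coe_unitMix]; ring)

@[simp] theorem unitMix_zero (t u : I) : unitMix 0 t u = t := Subtype.ext (by simp [coe_unitMix])

@[simp] theorem unitMix_one (t u : I) : unitMix 1 t u = u := Subtype.ext (by simp [coe_unitMix])

theorem lt_unitMix {a : ℝ} {s t u : I} (ht : a < t) (hu : a < u) : a < unitMix s t u :=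
  (convex_Ioi a) ht hu (sub_nonneg.2 s.2.2) s.2.1 (by ring)

theorem unitMix_lt {a : ℝ} {s t u : I} (ht : (t : ℝ) < a) (hu : (u : ℝ) < a) : unitMix s t u < a :=
  (convex_Iio a) ht hu (sub_nonneg.2 s.2.2) s.2.1 (by ring)

theorem ArcKind.height_unitMix (k : ArcKind) (s t u : I) :
    k.height (unitMix s t u) = (1 - s) * k.height t + s * k.height u := by
  cases k <;> simp only [height, coe_unitMix] <;> ring

theorem ArcKind.continuous_height (k : ArcKind) : Continuous k.height := by
  cases k <;> unfold height <;> fun_prop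

/-- A presentation of `X` as a union of arcs meeting only in `p` and `q`. -/
structure ArcModel {X J : Type*} [TopologicalSpace X] (k : J → ArcKind) (α : J → C(I, X))
    (p q : X) : Prop where
  surj : ∀ x, ∃ j t, α j t = x
  eq_p_iff : ∀ j t, α j t = p ↔ (k j).IsPEnd t
  eq_q_iff : ∀ j t, α j t = q ↔ (k j).IsQEnd t
  inj : ∀ j t j' t', α j t = α j' t' → α j t ≠ p → α j t ≠ q → j = j' ∧ t = t'
  newRay_unique : ∀ j j', k j = .newRay → k j' = .newRay → j = j'

variable {X J : Type*} [TopologicalSpace X] {k : J → ArcKind} {α : J → C(I, X)} {p q : X}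

theorem ArcModel.mem_iff (h : ArcModel k α p q) {R : J → I → Prop}
    (hp : ∀ j t j' t', (k j).IsPEnd t → (k j').IsPEnd t' → R j t → R j' t')
    (hq : ∀ j t j' t', (k j).IsQEnd t → (k j').IsQEnd t' → R j t → R j' t') (j : J) (t : I) :
    α j t ∈ {x | ∃ j t, R j t ∧ α j t = x} ↔ R j t := by
  refine ⟨?_, fun hR => ⟨j, t, hR, rfl⟩⟩
  rintro ⟨j', t', hR, e⟩
  by_cases h1 : α j' t' = p
  · exact hp _ _ _ _ ((h.eq_p_iff _ _).1 h1) ((h.eq_p_iff _ _).1 (e.symm.trans h1)) hR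
  by_cases h2 : α j' t' = q
  · exact hq _ _ _ _ ((h.eq_q_iff _ _).1 h2) ((h.eq_q_iff _ _).1 (e.symm.trans h2)) hR
  obtain ⟨rfl, rfl⟩ := h.inj _ _ _ _ e h1 h2
  exact hR

theorem ArcModel.injOn (h : ArcModel k α p q) {f : X → ℝ}
    (hf : ∀ j t, f (α j t) = (k j).height t) : InjOn f {x | f x ≤ 0} := by
  have key : ∀ j t, f (α j t) ≤ 0 → α j t = p ∨ k j = .newRay := by
    intro j t ht
    rw [hf] at ht
    rw [h.eq_p_iff]
    cases hk : k j <;> simp_all [ArcKind.height, ArcKind.IsPEnd]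
    · exact le_antisymm ht t.2.1
    · exact le_antisymm ht t.2.1
    · linarith
  have hp : ∀ j t, α j t = p → f p = 0 := by
    intro j t e
    rw [← e, hf]
    rw [h.eq_p_iff] at e
    cases hk : k j <;> simp_all [ArcKind.height, ArcKind.IsPEnd]
  have key' : ∀ j t, k j = .newRay → f (α j t) = f p → α j t = p := by
    intro j t hj e
    have : α j 0 = p := by rw [h.eq_p_iff, hj]; exact rfl
    rw [hp _ _ this, hf, hj] at e
    rw [h.eq_p_iff, hj]
    exact Subtype.ext (neg_eq_zero.1 e)
  intro x hx y hy hxy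
  obtain ⟨j, t, rfl⟩ := h.surj x
  obtain ⟨j', t', rfl⟩ := h.surj y
  rcases key j t hx with h1 | h1 <;> rcases key j' t' hy with h2 | h2
  · rw [h1, h2]
  · rw [h1] at hxy ⊢
    exact (key' _ _ h2 hxy.symm).symm
  · rw [h2] at hxy ⊢
    exact key' _ _ h1 hxy
  · obtain rfl := h.newRay_unique _ _ h1 h2
    rw [hf, hf, h1] at hxy
    rw [Subtype.ext (neg_injective hxy)]

variable [T2Space X] [Finite J]

theorem ArcModel.isProperMap (_ : ArcModel k α p q) [TopologicalSpace J] [DiscreteTopology J] :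
    IsProperMap fun z : J × I => α z.1 z.2 := by
  refine Continuous.isProperMap ?_
  rw [continuous_prod_of_discrete_left]
  exact fun j => (α j).continuous

theorem ArcModel.isQuotientMap (h : ArcModel k α p q) [TopologicalSpace J] [DiscreteTopology J] :
    IsQuotientMap fun z : J × I => α z.1 z.2 :=
  h.isProperMap.isClosedMap.isQuotientMap h.isProperMap.continuous fun x => by
    obtain ⟨j, t, rfl⟩ := h.surj x
    exact ⟨(j, t), rfl⟩

theorem ArcModel.isOpen (h : ArcModel k α p q) {D : Set X}
    (hD : ∀ j, IsOpen {t | α j t ∈ D}) : IsOpen D := by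
  let _ : TopologicalSpace J := ⊥
  have : DiscreteTopology J := ⟨rfl⟩
  rw [← h.isQuotientMap.isOpen_preimage]
  refine continuous_Prop.1 (continuous_prod_of_discrete_left.2 fun j => continuous_Prop.2 (hD j))

theorem ArcModel.exists_height (h : ArcModel k α p q) :
    ∃ f : X → ℝ, Continuous f ∧ ∀ j t, f (α j t) = (k j).height t := by
  let _ : TopologicalSpace J := ⊥
  have : DiscreteTopology J := ⟨rfl⟩
  choose j t hjt using h.surj
  have hp : ∀ k : ArcKind, ∀ t, k.IsPEnd t → k.height t = 0 := by
    rintro (_ | _ | _ | _) t ht <;> simp_all [ArcKind.IsPEnd, ArcKind.height]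
  have hq : ∀ k : ArcKind, ∀ t, k.IsQEnd t → k.height t = 1 := by
    rintro (_ | _ | _ | _) t ht <;> simp_all [ArcKind.IsQEnd, ArcKind.height]
  have hf : ∀ i s, (k (j (α i s))).height (t (α i s)) = (k i).height s := by
    intro i s
    have e := hjt (α i s)
    by_cases h1 : α i s = p
    · rw [hp _ _ ((h.eq_p_iff _ _).1 (e.trans h1)), hp _ _ ((h.eq_p_iff _ _).1 h1)]
    by_cases h2 : α i s = q
    · rw [hq _ _ ((h.eq_q_iff _ _).1 (e.trans h2)), hq _ _ ((h.eq_q_iff _ _).1 h2)]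
    obtain ⟨h3, h4⟩ := h.inj _ _ _ _ e.symm h1 h2
    rw [← h3, ← h4]
  refine ⟨fun x => (k (j x)).height (t x), ?_, hf⟩
  rw [h.isQuotientMap.continuous_iff, continuous_prod_of_discrete_left]
  intro i
  simp only [Function.comp_def, hf]
  exact (k i).continuous_height

theorem ArcModel.exists_deformation (h : ArcModel k α p q) {D : Set X} (c : J → C(I, I))
    (hD : ∀ s j t, α j t ∈ D → α j (unitMix s t (c j t)) ∈ D)
    (hc : ∀ j t, α j t ∈ D → α j t = p ∨ α j t = q → c j t = t) :
    ∃ H : C(I × D, D), ∀ s j t (hm : α j t ∈ D),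
      (H (s, ⟨α j t, hm⟩) : X) = α j (unitMix s t (c j t)) := by
  let _ : TopologicalSpace J := ⊥
  have : DiscreteTopology J := ⟨rfl⟩
  let Q : J × I → X := fun z => α z.1 z.2
  have hQ : IsProperMap (Prod.map (id : I → I) (D.restrictPreimage Q)) :=
    isProperMap_id.prodMap (h.isProperMap.restrictPreimage D)
  have hQs : Function.Surjective (Prod.map (id : I → I) (D.restrictPreimage Q)) := by
    rintro ⟨s, x, hx⟩
    obtain ⟨j, t, rfl⟩ := h.surj x
    exact ⟨(s, ⟨(j, t), hx⟩), rfl⟩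
  have hq := hQ.isClosedMap.isQuotientMap hQ.continuous hQs
  let qm : C(I × (Q ⁻¹' D : Set _), I × D) := ⟨_, hQ.continuous⟩
  have hqm : IsQuotientMap qm := hq
  have hcont : Continuous fun z : I × J × I => α z.2.1 (unitMix z.1 z.2.2 (c z.2.1 z.2.2)) := by
    have : Continuous fun z : J × I × I => α z.1 (unitMix z.2.1 z.2.2 (c z.1 z.2.2)) := by
      rw [continuous_prod_of_discrete_left]
      intro j
      exact (α j).continuous.comp (continuous_unitMix.comp (by fun_prop :
        Continuous fun x : I × I => (x.1, x.2, c j x.2)))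
    exact this.comp (by fun_prop : Continuous fun z : I × J × I => (z.2.1, z.1, z.2.2))
  let H₀ : C(I × (Q ⁻¹' D : Set _), D) :=
    ⟨fun z => ⟨α z.2.1.1 (unitMix z.1 z.2.1.2 (c z.2.1.1 z.2.1.2)), hD _ _ _ z.2.2⟩,
      Continuous.subtype_mk (hcont.comp (by fun_prop :
        Continuous fun z : I × (Q ⁻¹' D : Set _) => (z.1, z.2.1))) _⟩
  have hfac : Function.FactorsThrough H₀ qm := by
    rintro ⟨s, ⟨j, t⟩, hz⟩ ⟨s', ⟨j', t'⟩, hz'⟩ e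
    obtain rfl : s = s' := congrArg Prod.fst e
    have e' : α j t = α j' t' := congrArg (fun x => (x.2 : X)) e
    refine Subtype.ext ?_
    change α j (unitMix s t (c j t)) = α j' (unitMix s t' (c j' t'))
    by_cases hpq : α j t = p ∨ α j t = q
    · rw [hc j t hz hpq, hc j' t' hz' (e' ▸ hpq), unitMix_self, unitMix_self, e']
    · obtain ⟨rfl, rfl⟩ := h.inj _ _ _ _ e' (fun h => hpq (Or.inl h)) (fun h => hpq (Or.inr h))
      rfl
  refine ⟨hqm.lift H₀ hfac, fun s j t hm => ?_⟩
  exact congrArg Subtype.val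
    (DFunLike.congr_fun (hqm.lift_comp H₀ hfac) (s, ⟨(j, t), hm⟩))

theorem ArcModel.heightContractible (h : ArcModel k α p q) {f : X → ℝ}
    (hf : ∀ j t, f (α j t) = (k j).height t) {D : Set X} (c : J → C(I, I))
    (R : J → I → Prop) (hR : ∀ j t, α j t ∈ D ↔ R j t)
    (hconv : ∀ j s t u, R j t → R j u → R j (unitMix s t u)) {x₀ : X} (hx₀ : x₀ ∈ D)
    (hcx₀ : ∀ j t, R j t → α j (c j t) = x₀)
    (hc : ∀ j t, R j t → (k j).IsPEnd t ∨ (k j).IsQEnd t → c j t = t) :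
    HeightContractible f D (f x₀) := by
  obtain ⟨H, hH⟩ := h.exists_deformation (D := D) c
    (fun s j t ht => (hR _ _).2 (hconv _ _ _ _ ((hR _ _).1 ht)
      ((hR _ _).1 (by rwa [hcx₀ j t ((hR _ _).1 ht)]))))
    (fun j t ht hpq => hc j t ((hR _ _).1 ht) (by rwa [← h.eq_p_iff, ← h.eq_q_iff]))
  refine ⟨⟨x₀, hx₀⟩, H, ?_, ?_, ?_⟩
  · rintro ⟨x, hx⟩
    obtain ⟨j, t, rfl⟩ := h.surj x
    exact Subtype.ext (by rw [hH, unitMix_zero])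
  · rintro ⟨x, hx⟩
    obtain ⟨j, t, rfl⟩ := h.surj x
    exact Subtype.ext (by rw [hH, unitMix_one, hcx₀ j t ((hR _ _).1 hx)])
  · rintro s ⟨x, hx⟩
    obtain ⟨j, t, rfl⟩ := h.surj x
    rw [hH, hf, ArcKind.height_unitMix, hf, ← hcx₀ j t ((hR _ _).1 hx), hf]

theorem ArcModel.exists_heightRetraction (h : ArcModel k α p q) {f : X → ℝ}
    (hf : ∀ j t, f (α j t) = (k j).height t) : ∃ ρ, HeightRetraction f ρ := by
  classical
  obtain ⟨H, hH⟩ := h.exists_deformation (D := univ)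
    (fun j => if k j = .newRay then ContinuousMap.const I 0 else ContinuousMap.id I)
    (fun _ _ _ _ => mem_univ _) (fun j t _ hpq => by
      rw [h.eq_p_iff, h.eq_q_iff] at hpq
      cases hk : k j <;> simp_all [ArcKind.IsPEnd, ArcKind.IsQEnd])
  let ρ : C(I × X, X) := ⟨fun z => H (z.1, ⟨z.2, mem_univ _⟩), by fun_prop⟩
  have hρ : ∀ s j t, ρ (s, α j t) = α j (unitMix s t
      ((if k j = .newRay then ContinuousMap.const I 0 else ContinuousMap.id I : C(I, I)) t)) :=
    fun s j t => hH s j t (mem_univ _)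
  refine ⟨ρ, fun x => ?_, fun s x hx => ?_, fun s x hx => ?_⟩
  all_goals obtain ⟨j, t, rfl⟩ := h.surj x
  · rw [hρ, unitMix_zero]
  · rw [hf] at hx
    rw [hρ]
    cases hk : k j <;> simp_all [ArcKind.height]
    obtain rfl : t = 0 := le_antisymm hx t.2.1
    rw [unitMix_self]
  · rw [hf] at hx
    rw [hρ, hf, hf, ArcKind.height_unitMix]
    have := t.2.1
    cases hk : k j <;> simp_all [ArcKind.height]
    · obtain rfl : t = 0 := le_antisymm hx t.2.1
      simp
    · obtain rfl : t = 0 := le_antisymm hx t.2.1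
      simp
    · linarith

end Arcs

section PulsarHeight

variable {X J : Type*} [TopologicalSpace X] {k : J → ArcKind} {α : J → C(I, X)} {p q : X}

/-- The components of the part of positive height: the star of `q` and the open rays at `p`. -/
def upperRel (k : J → ArcKind) : Option {j // k j = .pRay} → J → I → Prop
  | none, j, t => k j = .leg ∧ 0 < t ∨ k j = .qRay
  | some l, j, t => j = l ∧ 0 < t

theorem not_upperRel_of_isPEnd {a : Option {j // k j = .pRay}} {j : J} {t : I}
    (h : (k j).IsPEnd t) : ¬ upperRel k a j t := by
  rcases a with _ | ⟨l, hl⟩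
  · cases hk : k j <;> simp_all [upperRel, ArcKind.IsPEnd]
  · rintro ⟨rfl, h0⟩
    rw [hl] at h
    exact h0.ne' h

theorem upperRel_iff_of_isQEnd {a : Option {j // k j = .pRay}} {j : J} {t : I}
    (h : (k j).IsQEnd t) : upperRel k a j t ↔ a = none := by
  rcases a with _ | ⟨l, hl⟩
  · cases hk : k j <;> simp_all [upperRel, ArcKind.IsQEnd]
  · simp only [reduceCtorEq, iff_false]
    rintro ⟨rfl, h0⟩
    rwa [hl] at h

theorem upperRel_unitMix {a : Option {j // k j = .pRay}} {j : J} {s t u : I}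
    (ht : upperRel k a j t) (hu : upperRel k a j u) : upperRel k a j (unitMix s t u) := by
  rcases a with _ | l
  · rcases ht with ht | ht
    · rcases hu with hu | hu
      · exact Or.inl ⟨ht.1, lt_unitMix (a := 0) ht.2 hu.2⟩
      · exact Or.inr hu
    · exact Or.inr ht
  · exact ⟨ht.1, lt_unitMix (a := 0) ht.2 hu.2⟩

theorem exists_upperRel_iff {j : J} {t : I} :
    (∃ a, upperRel k a j t) ↔ 0 < (k j).height t := by
  constructor
  · rintro ⟨_ | ⟨l, hl⟩, h⟩
    · rcases h with h | h
      · rw [h.1]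
        exact h.2
      · rw [h]
        exact one_pos
    · obtain ⟨rfl, h⟩ := h
      rw [hl]
      exact h
  · intro h
    cases hk : k j <;> rw [hk] at h
    · exact ⟨none, Or.inl ⟨hk, h⟩⟩
    · exact ⟨some ⟨j, hk⟩, rfl, h⟩
    · exact ⟨none, Or.inr hk⟩
    · exact ((neg_nonpos.2 t.2.1).not_gt h).elim

theorem upperRel_unique {a b : Option {j // k j = .pRay}} {j : J} {t : I}
    (ha : upperRel k a j t) (hb : upperRel k b j t) : a = b := by
  rcases a with _ | ⟨l, hl⟩ <;> rcases b with _ | ⟨l', hl'⟩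
  · rfl
  · obtain ⟨rfl, -⟩ := hb
    simp [upperRel, hl'] at ha
  · obtain ⟨rfl, -⟩ := ha
    simp [upperRel, hl] at hb
  · obtain rfl : l = l' := ha.1.symm.trans hb.1
    rfl

theorem isOpen_upperRel (a : Option {j // k j = .pRay}) (j : J) :
    IsOpen {t | upperRel k a j t} := by
  rcases a with _ | l
  · exact (isOpen_const.inter (isOpen_Ioi (a := (0 : I)))).union isOpen_const
  · exact isOpen_const.inter (isOpen_Ioi (a := (0 : I)))

/-- The points of the arcs whose parameters satisfy `R`. -/
def arcSet (α : J → C(I, X)) (R : J → I → Prop) : Set X := {x | ∃ j t, R j t ∧ α j t = x}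

theorem ArcModel.mem_upperSet_iff (h : ArcModel k α p q) {a : Option {j // k j = .pRay}} {j : J}
    {t : I} : α j t ∈ arcSet α (upperRel k a) ↔ upperRel k a j t :=
  h.mem_iff (fun _ _ _ _ h1 _ h3 => (not_upperRel_of_isPEnd h1 h3).elim)
    (fun _ _ _ _ h1 h2 h3 => (upperRel_iff_of_isQEnd h2).2 ((upperRel_iff_of_isQEnd h1).1 h3)) _ _

theorem ArcModel.mem_openArc_iff (h : ArcModel k α p q) {l : J} (hl : k l = .leg ∨ k l = .pRay)
    {j : J} {t : I} :
    α j t ∈ arcSet α (fun j t => j = l ∧ 0 < t ∧ t < 1) ↔ j = l ∧ 0 < t ∧ t < 1 := by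
  refine h.mem_iff (R := fun j t => j = l ∧ 0 < t ∧ t < 1) ?_ ?_ _ _
  · rintro j t - - h1 - ⟨rfl, h2, -⟩
    rcases hl with hl | hl <;> rw [hl] at h1 <;> exact (h2.ne' h1).elim
  · rintro j t - - h1 - ⟨rfl, -, h2⟩
    rcases hl with hl | hl <;> rw [hl] at h1
    · exact (h2.ne h1).elim
    · exact h1.elim

variable [T2Space X] [Finite J]

theorem ArcModel.heightContractible_upperSet (h : ArcModel k α p q) {f : X → ℝ}
    (hf : ∀ j t, f (α j t) = (k j).height t) {j₀ : J} (hj₀ : k j₀ = .leg)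
    (a : Option {j // k j = .pRay}) : HeightContractible f (arcSet α (upperRel k a)) 1 := by
  classical
  rcases a with _ | ⟨l, hl⟩
  · have hq : α j₀ 1 = q := (h.eq_q_iff _ _).2 (by rw [hj₀]; exact rfl)
    have := h.heightContractible hf (D := arcSet α (upperRel k none)) (x₀ := α j₀ 1)
      (fun j => if k j = .leg then ContinuousMap.const I 1 else ContinuousMap.const I 0)
      (upperRel k none) (fun _ _ => h.mem_upperSet_iff) (fun _ _ _ _ => upperRel_unitMix)
      (h.mem_upperSet_iff.2 (Or.inl ⟨hj₀, one_pos⟩))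
      (fun j t hR => by
        rw [hq, h.eq_q_iff]
        rcases hR with hR | hR
        · simp [hR.1, ArcKind.IsQEnd]
        · simp [hR, ArcKind.IsQEnd])
      (fun j t hR he => by
        have h1 := he.resolve_left fun h1 => not_upperRel_of_isPEnd h1 hR
        rcases hR with hR | hR
        · rw [hR.1] at h1
          simpa [hR.1] using h1.symm
        · rw [hR] at h1
          simpa [hR] using h1.symm)
    rwa [hf, hj₀] at this
  · have := h.heightContractible hf (D := arcSet α (upperRel k (some ⟨l, hl⟩))) (x₀ := α l 1)
      (fun j => ContinuousMap.const I 1)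
      (upperRel k (some ⟨l, hl⟩)) (fun _ _ => h.mem_upperSet_iff) (fun _ _ _ _ => upperRel_unitMix)
      (h.mem_upperSet_iff.2 ⟨rfl, one_pos⟩)
      (fun j t hR => by obtain ⟨rfl, -⟩ := hR; rfl)
      (fun j t hR he => by
        rcases he with he | he
        · exact (not_upperRel_of_isPEnd he hR).elim
        · exact ((Option.some_ne_none _) ((upperRel_iff_of_isQEnd he).1 hR)).elim)
    rwa [hf, hl] at this

theorem ArcModel.heightContractible_openArc (h : ArcModel k α p q) {f : X → ℝ}
    (hf : ∀ j t, f (α j t) = (k j).height t) {l : J} (hl : k l = .leg ∨ k l = .pRay) :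
    HeightContractible f (arcSet α (fun j t => j = l ∧ 0 < t ∧ t < 1)) (1 / 2) := by
  let c : I := ⟨1 / 2, by norm_num, by norm_num⟩
  have hc0 : 0 < c := Subtype.coe_lt_coe.1 (by simp [c])
  have hc1 : c < 1 := Subtype.coe_lt_coe.1 (by simp only [c, Icc.coe_one]; norm_num)
  have := h.heightContractible hf (D := arcSet α (fun j t => j = l ∧ 0 < t ∧ t < 1))
    (x₀ := α l c) (fun _ => ContinuousMap.const I c)
    (fun j t => j = l ∧ 0 < t ∧ t < 1) (fun _ _ => h.mem_openArc_iff hl)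
    (fun j s t u ht hu => ⟨ht.1, lt_unitMix (a := 0) ht.2.1 hu.2.1,
      unitMix_lt (a := 1) ht.2.2 hu.2.2⟩)
    ((h.mem_openArc_iff hl).2 ⟨rfl, hc0, hc1⟩)
    (fun j t hR => by rw [hR.1]; rfl)
    (fun j t hR he => by
      obtain ⟨rfl, h0, h1⟩ := hR
      rcases hl with hl | hl <;> rw [hl] at he
      · exact (he.elim h0.ne' h1.ne).elim
      · exact (he.elim h0.ne' id).elim)
  have e : f (α l c) = 1 / 2 := by
    rw [hf]
    rcases hl with hl | hl <;> rw [hl] <;> rfl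
  rwa [e] at this

theorem ArcModel.heightContractible_neg (h : ArcModel k α p q) {f : X → ℝ}
    (hf : ∀ j t, f (α j t) = (k j).height t) {n : J} (hn : k n = .newRay) {c : ℝ} (hc : -1 ≤ c)
    (hc' : c < 0) : HeightContractible f {x | f x < 0} c := by
  let d : I := ⟨-c, by linarith, by linarith⟩
  have hd : f (α n d) = c := by
    rw [hf, hn]
    exact neg_neg c
  have := h.heightContractible hf (D := {x | f x < 0}) (x₀ := α n d)
    (fun _ => ContinuousMap.const I d) (fun j t => j = n ∧ 0 < t)
    (fun j t => by
      rw [mem_ofPred_eq, hf]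
      constructor
      · intro h1
        have := t.2.1
        cases hk : k j <;> rw [hk] at h1 <;> simp only [ArcKind.height] at h1
        · linarith
        · linarith
        · linarith
        · exact ⟨h.newRay_unique _ _ hk hn, by simpa using h1⟩
      · rintro ⟨rfl, h1⟩
        rw [hn]
        exact neg_lt_zero.2 h1)
    (fun j s t u ht hu => ⟨ht.1, lt_unitMix (a := 0) ht.2 hu.2⟩)
    (hd.trans_lt hc')
    (fun j t hR => by rw [hR.1]; rfl)
    (fun j t hR he => by
      obtain ⟨rfl, h0⟩ := hR
      rw [hn] at he
      exact (he.elim h0.ne' id).elim)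
  rwa [hd] at this

theorem ArcModel.heightContractible_lt_one (h : ArcModel k α p q) {f : X → ℝ}
    (hf : ∀ j t, f (α j t) = (k j).height t) {n : J} (hn : k n = .newRay) :
    HeightContractible f {x | f x < 1} 0 := by
  have hp : α n 0 = p := (h.eq_p_iff _ _).2 (by rw [hn]; exact rfl)
  have hd : f (α n 0) = 0 := by
    rw [hf, hn]
    exact neg_zero
  have := h.heightContractible hf (D := {x | f x < 1}) (x₀ := α n 0)
    (fun _ => ContinuousMap.const I 0) (fun j t => (k j).height t < 1)
    (fun j t => by rw [mem_ofPred_eq, hf])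
    (fun j s t u ht hu => by
      rw [ArcKind.height_unitMix]
      exact (convex_Iio (1 : ℝ)) ht hu (sub_nonneg.2 s.2.2) s.2.1 (by ring))
    (hd.trans_lt one_pos)
    (fun j t hR => by
      rw [hp, h.eq_p_iff]
      cases hk : k j <;> rw [hk] at hR
      · exact rfl
      · exact rfl
      · exact (lt_irrefl _ hR).elim
      · exact rfl)
    (fun j t hR he => by
      cases hk : k j <;> simp_all [ArcKind.height, ArcKind.IsPEnd, ArcKind.IsQEnd]
      rcases he with rfl | rfl
      · rfl
      · exact (lt_irrefl _ hR).elim)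
  rwa [hd] at this

theorem ArcModel.exists_rayHeight (h : ArcModel k α p q) {G : Type*} [TopologicalSpace G]
    {i : G → X} (hi : IsEmbedding i)
    (hri : ∀ x, x ∈ range i ↔ ∃ j t, k j ≠ .newRay ∧ α j t = x) {j₀ n : J}
    (hj₀ : k j₀ = .leg) (hn : k n = .newRay) :
    ∃ (f : X → ℝ) (C : Option {j // k j = .pRay} → Set X)
      (E : Option {j // (k j = .leg ∨ k j = .pRay) ∧ j ≠ j₀} → Set X), RayHeight f i C E := by
  classical
  obtain ⟨f, hfc, hf⟩ := h.exists_height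
  let v : Option {j // (k j = .leg ∨ k j = .pRay) ∧ j ≠ j₀} → J := fun o => o.elim j₀ (·.1)
  have hv : ∀ o, k (v o) = .leg ∨ k (v o) = .pRay := by
    rintro (_ | o)
    exacts [Or.inl hj₀, o.2.1]
  have hvi : Function.Injective v := by
    rintro (_ | a) (_ | b) e
    exacts [rfl, (b.2.2 e.symm).elim, (a.2.2 e).elim, congrArg some (Subtype.ext e)]
  have hvs : ∀ j, k j = .leg ∨ k j = .pRay → ∃ o, v o = j := by
    intro j hj
    by_cases e : j = j₀
    · exact ⟨none, e.symm⟩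
    · exact ⟨some ⟨j, hj, e⟩, rfl⟩
  refine ⟨f, fun a => arcSet α (upperRel k a),
    fun b => arcSet α (fun j t => j = v b ∧ 0 < t ∧ t < 1), hfc, h.injOn hf, hi, ?_,
    h.exists_heightRetraction hf, fun a => h.isOpen fun j => ?_, fun a b hab => ?_, ?_,
    fun a => h.heightContractible_upperSet hf hj₀ a, fun b => h.isOpen fun j => ?_,
    fun a b hab => ?_, ?_, fun b => h.heightContractible_openArc hf (hv b),
    fun c hc hc' => h.heightContractible_neg hf hn hc hc', h.heightContractible_lt_one hf hn⟩
  · ext x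
    rw [hri]
    constructor
    · rintro ⟨j, t, hj, rfl⟩
      have := t.2.1
      rw [mem_ofPred_eq, hf]
      cases hk : k j <;> simp_all [ArcKind.height]
    · intro hx
      obtain ⟨j, t, rfl⟩ := h.surj x
      rw [mem_ofPred_eq, hf] at hx
      by_cases hk : k j = .newRay
      · rw [hk] at hx
        obtain rfl : t = 0 := le_antisymm (neg_nonneg.1 hx) t.2.1
        refine ⟨j₀, 0, by simp [hj₀], ?_⟩
        rw [(h.eq_p_iff j₀ 0).2 (by rw [hj₀]; exact rfl),
          (h.eq_p_iff j 0).2 (by rw [hk]; exact rfl)]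
      · exact ⟨j, t, hk, rfl⟩
  · simp only [h.mem_upperSet_iff]
    exact isOpen_upperRel a j
  · refine Set.disjoint_left.2 fun x ha hb => hab ?_
    obtain ⟨j, t, rfl⟩ := h.surj x
    exact upperRel_unique (h.mem_upperSet_iff.1 ha) (h.mem_upperSet_iff.1 hb)
  · ext x
    obtain ⟨j, t, rfl⟩ := h.surj x
    simp only [mem_iUnion, h.mem_upperSet_iff, mem_ofPred_eq, hf, exists_upperRel_iff]
  · simp only [h.mem_openArc_iff (hv b)]
    exact isOpen_const.inter (isOpen_Ioo (a := (0 : I)) (b := 1))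
  · refine Set.disjoint_left.2 fun x ha hb => hab (hvi ?_)
    obtain ⟨j, t, rfl⟩ := h.surj x
    exact ((h.mem_openArc_iff (hv a)).1 ha).1.symm.trans ((h.mem_openArc_iff (hv b)).1 hb).1
  · ext x
    obtain ⟨j, t, rfl⟩ := h.surj x
    simp only [mem_iUnion, h.mem_openArc_iff (hv _), mem_ofPred_eq, hf]
    constructor
    · rintro ⟨b, rfl, h0, h1⟩
      rcases hv b with hb | hb <;> rw [hb] <;> exact ⟨h0, h1⟩
    · intro ht
      have h0 := t.2.1
      cases hk : k j <;> rw [hk] at ht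
      · obtain ⟨b, hb⟩ := hvs j (Or.inl hk)
        exact ⟨b, hb.symm, ht⟩
      · obtain ⟨b, hb⟩ := hvs j (Or.inr hk)
        exact ⟨b, hb.symm, ht⟩
      · exact (lt_irrefl _ ht.2).elim
      · exact ((neg_nonpos.2 h0).not_gt ht.1).elim

theorem ArcModel.isFreeExtension (h : ArcModel k α p q) {G : Type*} [TopologicalSpace G]
    {i : G → X} (hi : IsEmbedding i)
    (hri : ∀ x, x ∈ range i ↔ ∃ j t, k j ≠ .newRay ∧ α j t = x) {j₀ j₁ n : J}
    (hj₀ : k j₀ = .leg) (hj₁ : k j₁ = .leg) (hj : j₁ ≠ j₀) (hn : k n = .newRay)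
    (hG : PathConnectedSpace (UConf 3 G)) :
    PathConnectedSpace (UConf 3 X) ∧
      ∃ d : ℕ, 1 ≤ d ∧ IsFreeExtension (UConf 3 X) (UConf 3 G) (Fin d) := by
  classical
  obtain ⟨f, C, E, hC⟩ := h.exists_rayHeight hi hri hj₀ hn
  obtain ⟨h1, h2⟩ := hC.isFreeExtension hG
  refine ⟨h1, _, ?_, h2.congr (Finite.equivFin _)⟩
  have : Nonempty ((Empty ⊕ (Option {j // k j = .pRay} ×
      {j // (k j = .leg ∨ k j = .pRay) ∧ j ≠ j₀})) ⊕
      (Unit × {j // (k j = .leg ∨ k j = .pRay) ∧ j ≠ j₀})) :=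
    ⟨Sum.inr ((), ⟨j₁, Or.inl hj₁, hj⟩)⟩
  exact Nat.card_pos

end PulsarHeight

section PathConnected
variable {X J : Type*} [TopologicalSpace X] {α : J → C(I, X)} {p q : X} {n : ℕ}

theorem joined_uconfMk {a b : {a : Fin n → X // Function.Injective a}} (H : Fin n → C(I, X))
    (hH : ∀ s, Function.Injective fun i => H i s) (h0 : ∀ i, H i 0 = a.1 i)
    (h1 : ∀ i, H i 1 = b.1 i) : Joined (uconfMk a) (uconfMk b) := by
  refine ⟨⟨⟨fun s => uconfMk ⟨fun i => H i s, hH s⟩,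
    isOpenQuotientMap_uconfMk.continuous.comp ?_⟩, ?_, ?_⟩⟩
  · exact Continuous.subtype_mk (by fun_prop) _
  · exact congrArg uconfMk (Subtype.ext (funext h0))
  · exact congrArg uconfMk (Subtype.ext (funext h1))

theorem ArcModel.injective_leg (h : ArcModel (fun _ => .leg) α p q) (j : J) :
    Function.Injective (α j) := by
  intro t t' e
  by_cases h1 : α j t = p
  · exact ((h.eq_p_iff j t).1 h1).trans ((h.eq_p_iff j t').1 (e.symm.trans h1)).symm
  by_cases h2 : α j t = q
  · exact ((h.eq_q_iff j t).1 h2).trans ((h.eq_q_iff j t').1 (e.symm.trans h2)).symm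
  exact (h.inj _ _ _ _ e h1 h2).2

theorem joined_of_forall_mem_range {β : C(I, X)} (hβ : Function.Injective β)
    {a b : {a : Fin n → X // Function.Injective a}} (ha : ∀ i, a.1 i ∈ range β)
    (hb : ∀ i, b.1 i ∈ range β) : Joined (uconfMk a) (uconfMk b) := by
  have key : ∀ a : {a : Fin n → X // Function.Injective a}, (∀ i, a.1 i ∈ range β) →
      ∃ t : Fin n → I, ∃ ht : StrictMono t,
        uconfMk ⟨β ∘ t, hβ.comp ht.injective⟩ = uconfMk a := by
    intro a ha
    choose t ht using ha
    have hti : Function.Injective t := fun i j e => a.2 (by rw [← ht i, ← ht j, e])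
    refine ⟨t ∘ Tuple.sort t, (Tuple.monotone_sort t).strictMono_of_injective
      (hti.comp (Tuple.sort t).injective), ?_⟩
    refine (uconfMk_eq_iff.2 ⟨Tuple.sort t, funext fun i => ?_⟩).symm
    exact (ht _).symm
  obtain ⟨t, ht, hta⟩ := key a ha
  obtain ⟨u, hu, hub⟩ := key b hb
  rw [← hta, ← hub]
  refine joined_uconfMk (fun i => ⟨fun s => β (unitMix s (t i) (u i)),
    β.continuous.comp (continuous_unitMix.comp (by fun_prop : Continuous fun s : I =>
      (s, t i, u i)))⟩) (fun s => hβ.comp (StrictMono.injective fun i j hij => ?_))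
      (fun i => by simp) (fun i => by simp)
  have h1 : (t i : ℝ) < t j := ht hij
  have h2 : (u i : ℝ) < u j := hu hij
  have h3 := s.2.1
  have h4 := s.2.2
  refine Subtype.coe_lt_coe.1 ?_
  rw [coe_unitMix, coe_unitMix]
  rcases h3.eq_or_lt with h | h
  · rw [← h]
    linarith
  · nlinarith

theorem ArcModel.exists_joined_forall_mem_range (h : ArcModel (fun _ => .leg) α p q) (j₀ : J)
    (S : Finset (Fin n)) :
    ∀ a : {a : Fin n → X // Function.Injective a}, (∀ i, a.1 i ∈ range (α j₀) ∨ i ∈ S) →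
      ∃ b : {a : Fin n → X // Function.Injective a}, (∀ i, b.1 i ∈ range (α j₀)) ∧
        Joined (uconfMk a) (uconfMk b) := by
  classical
  have hinj := h.injective_leg
  have hp : p ∈ range (α j₀) := ⟨0, (h.eq_p_iff j₀ 0).2 rfl⟩
  have hq : q ∈ range (α j₀) := ⟨1, (h.eq_q_iff j₀ 1).2 rfl⟩
  induction S using Finset.strongInduction with
  | H S ih =>
  intro a ha
  by_cases hall : ∀ i, a.1 i ∈ range (α j₀)
  · exact ⟨a, hall, Joined.refl _⟩
  have hrep : ∀ i, ∃ j t, α j t = a.1 i ∧ (a.1 i ∈ range (α j₀) → j = j₀) := by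
    intro i
    by_cases hi : a.1 i ∈ range (α j₀)
    · obtain ⟨t, ht⟩ := hi
      exact ⟨j₀, t, ht, fun _ => rfl⟩
    · obtain ⟨j, t, ht⟩ := h.surj (a.1 i)
      exact ⟨j, t, ht, fun h => (hi h).elim⟩
  choose j t hjt hj using hrep
  obtain ⟨m, hm, hmax⟩ := (Finset.univ.filter fun i => a.1 i ∉ range (α j₀)).exists_max_image t
    (by push Not at hall; simpa [Finset.Nonempty] using hall)
  simp only [Finset.mem_filter, Finset.mem_univ, true_and] at hm hmax
  let e : I := ⟨1 / 2, by norm_num, by norm_num⟩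
  -- First move the points of the leg `j₀` away from `q`, then move the point `m` to `q`.
  let H : Fin n → C(I, X) := fun i => if a.1 i ∈ range (α j₀) then
    ⟨fun s => α j₀ (unitMix (e * s) (t i) 0), (α j₀).continuous.comp
      (continuous_unitMix.comp (by fun_prop : Continuous fun s : I => (e * s, t i, (0 : I))))⟩
    else ContinuousMap.const I (a.1 i)
  have Hin : ∀ i, a.1 i ∈ range (α j₀) → ∀ s, H i s = α j₀ (unitMix (e * s) (t i) 0) := by
    intro i hi s
    simp only [H, if_pos hi]
    rfl
  have Hout : ∀ i, a.1 i ∉ range (α j₀) → ∀ s, H i s = a.1 i := by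
    intro i hi s
    simp only [H, if_neg hi]
    rfl
  have Hmem : ∀ i s, H i s ∈ range (α j₀) ↔ a.1 i ∈ range (α j₀) := by
    intro i s
    by_cases hi : a.1 i ∈ range (α j₀)
    · rw [Hin i hi]
      exact iff_of_true ⟨_, rfl⟩ hi
    · rw [Hout i hi]
  have Hinj : ∀ s, Function.Injective fun i => H i s := by
    intro s i i' hii'
    have hmem : a.1 i ∈ range (α j₀) ↔ a.1 i' ∈ range (α j₀) := by
      rw [← Hmem i s, ← Hmem i' s]
      exact iff_of_eq (congrArg (· ∈ range (α j₀)) hii')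
    by_cases hi : a.1 i ∈ range (α j₀)
    · have hi' := hmem.1 hi
      have h1 : H i s = H i' s := hii'
      rw [Hin i hi, Hin i' hi'] at h1
      have h2 := congrArg Subtype.val (hinj _ h1)
      simp only [coe_unitMix, Icc.coe_zero, mul_zero, add_zero] at h2
      have h3 : (1 : ℝ) - ((e * s : I) : ℝ) ≠ 0 := by
        have : ((e * s : I) : ℝ) = 1 / 2 * s := rfl
        have := s.2.2
        intro h
        linarith
      refine a.2 ?_
      rw [← hjt i, ← hjt i', hj i hi, hj i' hi', Subtype.ext (mul_left_cancel₀ h3 h2)]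
    · have hi' := mt hmem.2 hi
      have h1 : H i s = H i' s := hii'
      rw [Hout i hi, Hout i' hi'] at h1
      exact a.2 h1
  let b : {a : Fin n → X // Function.Injective a} := ⟨fun i => H i 1, Hinj 1⟩
  have hab : Joined (uconfMk a) (uconfMk b) := by
    refine joined_uconfMk H Hinj (fun i => ?_) fun i => rfl
    by_cases hi : a.1 i ∈ range (α j₀)
    · rw [Hin i hi, mul_zero, unitMix_zero, ← hj i hi, hjt]
    · rw [Hout i hi]
  let K : Fin n → C(I, X) := fun i => if i = m then
    ⟨fun s => α (j m) (unitMix s (t m) 1), (α (j m)).continuous.comp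
      (continuous_unitMix.comp (by fun_prop : Continuous fun s : I => (s, t m, (1 : I))))⟩
    else ContinuousMap.const I (b.1 i)
  have Km : ∀ s, K m s = α (j m) (unitMix s (t m) 1) := by
    intro s
    simp only [K, if_true]
    rfl
  have Kne : ∀ i, i ≠ m → ∀ s, K i s = b.1 i := by
    intro i hi s
    simp only [K, if_neg hi]
    rfl
  have hmix : ∀ s, t m ≤ unitMix s (t m) 1 := by
    intro s
    refine Subtype.coe_le_coe.1 ?_
    rw [coe_unitMix, Icc.coe_one]
    nlinarith [s.2.1, (t m).2.2]
  have htm : t m ≠ 0 := by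
    intro h0
    refine hm ?_
    rw [← hjt m, (h.eq_p_iff _ _).2 h0]
    exact hp
  have hKb : ∀ i, i ≠ m → ∀ s, b.1 i ≠ α (j m) (unitMix s (t m) 1) := by
    intro i hi s he
    by_cases hmi : a.1 i ∈ range (α j₀)
    · have hb : b.1 i = α j₀ (unitMix (e * 1) (t i) 0) := Hin i hmi 1
      rw [mul_one] at hb
      have hbp : b.1 i ≠ p := by
        rw [he, Ne, h.eq_p_iff]
        intro h0
        exact htm (le_antisymm ((hmix s).trans h0.le) (t m).2.1)
      have hbq : b.1 i ≠ q := by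
        rw [hb, Ne, h.eq_q_iff]
        intro h1
        have h2 := congrArg Subtype.val h1
        rw [coe_unitMix, Icc.coe_zero, Icc.coe_one] at h2
        have h3 : (e : ℝ) = 1 / 2 := rfl
        rw [h3] at h2
        linarith [(t i).2.2]
      have hjm := (h.inj _ _ _ _ (hb.symm.trans he) (hb ▸ hbp) (hb ▸ hbq)).1
      refine hm ?_
      rw [← hjt m, ← hjm]
      exact ⟨_, rfl⟩
    · have hb : b.1 i = a.1 i := Hout i hmi 1
      rw [hb, ← hjt i] at he
      have hap : α (j i) (t i) ≠ p := fun h => hmi (hjt i ▸ h ▸ hp)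
      have haq : α (j i) (t i) ≠ q := fun h => hmi (hjt i ▸ h ▸ hq)
      obtain ⟨h1, h2⟩ := h.inj _ _ _ _ he hap haq
      have h3 : t i = t m := le_antisymm (hmax i hmi) (h2 ▸ hmix s)
      exact hi (a.2 (by rw [← hjt i, ← hjt m, h1, h3]))
  have Kinj : ∀ s, Function.Injective fun i => K i s := by
    intro s i i' hii'
    have h1 : K i s = K i' s := hii'
    by_cases hi : i = m <;> by_cases hi' : i' = m
    · rw [hi, hi']
    · rw [hi, Km, Kne _ hi'] at h1
      exact (hKb _ hi' _ h1.symm).elim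
    · rw [hi', Km, Kne _ hi] at h1
      exact (hKb _ hi _ h1).elim
    · rw [Kne _ hi, Kne _ hi'] at h1
      exact b.2 h1
  let c : {a : Fin n → X // Function.Injective a} := ⟨fun i => K i 1, Kinj 1⟩
  have hbc : Joined (uconfMk b) (uconfMk c) := by
    refine joined_uconfMk K Kinj (fun i => ?_) fun i => rfl
    by_cases hi : i = m
    · rw [hi, Km, unitMix_zero, hjt]
      exact (Hout m hm 1).symm
    · rw [Kne i hi]
  obtain ⟨d, hd, hcd⟩ := ih (S.erase m) (Finset.erase_ssubset ((ha m).resolve_left hm)) c (by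
    intro i
    by_cases hi : i = m
    · left
      have : c.1 i = q := by
        change K i 1 = q
        rw [hi, Km, unitMix_one]
        exact (h.eq_q_iff _ _).2 rfl
      rw [this]
      exact hq
    · refine (ha i).imp (fun hi' => ?_) fun hi' => Finset.mem_erase.2 ⟨hi, hi'⟩
      change K i 1 ∈ _
      rw [Kne i hi]
      exact (Hmem i 1).2 hi')
  exact ⟨d, hd, hab.trans (hbc.trans hcd)⟩

theorem ArcModel.pathConnectedSpace_uconf (h : ArcModel (fun _ => .leg) α p q) (j₀ : J) (n : ℕ) :
    PathConnectedSpace (UConf n X) where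
  nonempty := by
    have : Infinite I := Icc.infinite zero_lt_one
    let g : Fin n ↪ I := Fin.valEmbedding.trans (Infinite.natEmbedding I)
    exact ⟨uconfMk ⟨α j₀ ∘ g, (h.injective_leg j₀).comp g.injective⟩⟩
  joined x y := by
    obtain ⟨a, rfl⟩ := isOpenQuotientMap_uconfMk.surjective x
    obtain ⟨b, rfl⟩ := isOpenQuotientMap_uconfMk.surjective y
    obtain ⟨a', ha', haa'⟩ := h.exists_joined_forall_mem_range j₀ Finset.univ a (by simp)
    obtain ⟨b', hb', hbb'⟩ := h.exists_joined_forall_mem_range j₀ Finset.univ b (by simp)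
    exact haa'.trans
      ((joined_of_forall_mem_range (h.injective_leg j₀) ha' hb').trans hbb'.symm)

end PathConnected

section Pulsar
variable {E : Type*} [TopologicalSpace E] {m r : ℕ} {p q : E} {γ : Fin m → C(I, E)} {Θ : Set E}

/-- The arcs `γ` join `p` to `q`, meet only there, and have union `Θ`. -/
structure IsTheta (γ : Fin m → C(I, E)) (p q : E) (Θ : Set E) : Prop where
  injective : ∀ i, Function.Injective (γ i)
  zero : ∀ i, γ i 0 = p
  one : ∀ i, γ i 1 = q
  eq_or_eq : ∀ i j, i ≠ j → ∀ s t, γ i s = γ j t → γ i s = p ∨ γ i s = q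
  iUnion_eq : ⋃ i, range (γ i) = Θ

/-- The rays `δ` start at `p` or `q` and are otherwise disjoint from `Θ` and from each other. -/
structure IsRays (δ : Fin r → C(I, E)) (p q : E) (Θ : Set E) : Prop where
  injective : ∀ j, Function.Injective (δ j)
  zero : ∀ j, δ j 0 = p ∨ δ j 0 = q
  eq_of_mem : ∀ j t, δ j t ∈ Θ → δ j t = δ j 0
  eq_of_eq : ∀ j l, j ≠ l → ∀ s t, δ j s = δ l t → δ j s = δ j 0

theorem IsTheta.eq_p_iff (h : IsTheta γ p q Θ) (i : Fin m) (t : I) : γ i t = p ↔ t = 0 := by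
  rw [← h.zero i, (h.injective i).eq_iff]

theorem IsTheta.eq_q_iff (h : IsTheta γ p q Θ) (i : Fin m) (t : I) : γ i t = q ↔ t = 1 := by
  rw [← h.one i, (h.injective i).eq_iff]

theorem IsTheta.mem (h : IsTheta γ p q Θ) (i : Fin m) (t : I) : γ i t ∈ Θ :=
  h.iUnion_eq ▸ mem_iUnion.2 ⟨i, t, rfl⟩

theorem IsTheta.symm (h : IsTheta γ p q Θ) :
    IsTheta (fun i => (γ i).comp ⟨unitInterval.symm, unitInterval.continuous_symm⟩) q p Θ where
  injective i := (h.injective i).comp unitInterval.symm_bijective.injective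
  zero i := by simp [h.one]
  one i := by simp [h.zero]
  eq_or_eq i j hij s t e := (h.eq_or_eq i j hij _ _ e).symm
  iUnion_eq := by
    rw [← h.iUnion_eq]
    refine iUnion_congr fun i => ?_
    exact unitInterval.symm_bijective.surjective.range_comp (γ i)

theorem IsTheta.pathConnectedSpace_uconf (h : IsTheta γ p q Θ) (i₀ : Fin m) (n : ℕ) :
    PathConnectedSpace (UConf n Θ) := by
  have hM : ArcModel (fun _ => .leg)
      (fun i => (⟨fun t => ⟨γ i t, h.mem i t⟩, by fun_prop⟩ : C(I, Θ)))
      (⟨p, h.zero i₀ ▸ h.mem i₀ 0⟩ : Θ) ⟨q, h.one i₀ ▸ h.mem i₀ 1⟩ :=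
    { surj := by
        rintro ⟨x, hx⟩
        obtain ⟨i, t, rfl⟩ := mem_iUnion.1 (h.iUnion_eq.symm.subset hx)
        exact ⟨i, t, rfl⟩
      eq_p_iff := fun i t => Subtype.ext_iff.trans (h.eq_p_iff i t)
      eq_q_iff := fun i t => Subtype.ext_iff.trans (h.eq_q_iff i t)
      inj := by
        intro i s j t e hp hq
        have e' : γ i s = γ j t := congrArg Subtype.val e
        by_cases hij : i = j
        · subst hij
          exact ⟨rfl, h.injective i e'⟩
        · rcases h.eq_or_eq i j hij s t e' with h1 | h1
          · exact (hp (Subtype.ext h1)).elim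
          · exact (hq (Subtype.ext h1)).elim
      newRay_unique := nofun }
  exact hM.pathConnectedSpace_uconf i₀ n

theorem IsRays.symm {δ : Fin r → C(I, E)} (h : IsRays δ p q Θ) : IsRays δ q p Θ :=
  ⟨h.injective, fun j => (h.zero j).symm, h.eq_of_mem, h.eq_of_eq⟩

variable [T2Space E] {δ : Fin (r + 1) → C(I, E)}

theorem IsRays.isFreeExtension_of_last_eq (hδ : IsRays δ p q Θ) (hγ : IsTheta γ p q Θ) (hpq : p ≠ q)
    (hm : 2 ≤ m) (hlast : δ (Fin.last r) 0 = p) {P P' : Set E} (hP : P = Θ ∪ ⋃ j, range (δ j))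
    (hP' : P' = Θ ∪ ⋃ j : Fin r, range (δ j.castSucc)) (hc : PathConnectedSpace (UConf 3 P')) :
    PathConnectedSpace (UConf 3 P) ∧
      ∃ d : ℕ, 1 ≤ d ∧ IsFreeExtension (UConf 3 P) (UConf 3 P') (Fin d) := by
  classical
  let k : Fin m ⊕ Fin (r + 1) → ArcKind := Sum.elim (fun _ => .leg) fun j =>
    if j = Fin.last r then .newRay else if δ j 0 = p then .pRay else .qRay
  let β : Fin m ⊕ Fin (r + 1) → C(I, E) := Sum.elim γ δ
  have hβ : ∀ j t, β j t ∈ P := by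
    rw [hP]
    rintro (i | j) t
    · exact Or.inl (hγ.mem i t)
    · exact Or.inr (mem_iUnion.2 ⟨j, t, rfl⟩)
  let α : Fin m ⊕ Fin (r + 1) → C(I, P) := fun j => ⟨fun t => ⟨β j t, hβ j t⟩, by fun_prop⟩
  let i₀ : Fin m := ⟨0, by omega⟩
  have hpΘ : p ∈ Θ := hγ.zero i₀ ▸ hγ.mem i₀ 0
  have hqΘ : q ∈ Θ := hγ.one i₀ ▸ hγ.mem i₀ 1
  have hδp : ∀ j t, δ j t = p ↔ δ j 0 = p ∧ t = 0 := by
    intro j t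
    refine ⟨fun e => ?_, fun e => e.2 ▸ e.1⟩
    have h1 := hδ.eq_of_mem j t (e ▸ hpΘ)
    exact ⟨h1.symm.trans e, hδ.injective j h1⟩
  have hδq : ∀ j t, δ j t = q ↔ δ j 0 = q ∧ t = 0 := by
    intro j t
    refine ⟨fun e => ?_, fun e => e.2 ▸ e.1⟩
    have h1 := hδ.eq_of_mem j t (e ▸ hqΘ)
    exact ⟨h1.symm.trans e, hδ.injective j h1⟩
  have hkp : ∀ j t, β j t = p ↔ (k j).IsPEnd t := by
    rintro (i | j) t
    · exact hγ.eq_p_iff i t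
    · change δ j t = p ↔ _
      rw [hδp]
      by_cases h1 : j = Fin.last r
      · simp [k, h1, hlast, ArcKind.IsPEnd]
      · by_cases h2 : δ j 0 = p <;> simp [k, h1, h2, ArcKind.IsPEnd]
  have hkq : ∀ j t, β j t = q ↔ (k j).IsQEnd t := by
    rintro (i | j) t
    · exact hγ.eq_q_iff i t
    · change δ j t = q ↔ _
      rw [hδq]
      by_cases h1 : j = Fin.last r
      · simp [k, h1, hlast, ArcKind.IsQEnd, hpq]
      · by_cases h2 : δ j 0 = p
        · simp [k, h1, h2, ArcKind.IsQEnd, hpq]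
        · simp [k, h1, ArcKind.IsQEnd, (hδ.zero j).resolve_left h2, hpq.symm]
  have hinj : ∀ j t j' t', β j t = β j' t' → β j t ≠ p → β j t ≠ q → j = j' ∧ t = t' := by
    have hγδ : ∀ i s j t, γ i s = δ j t → δ j t = p ∨ δ j t = q := by
      intro i s j t e
      have := hδ.eq_of_mem j t (e ▸ hγ.mem i s)
      rw [this]
      exact hδ.zero j
    rintro (i | i) s (j | j) t e hp hq
    · by_cases hij : i = j
      · subst hij
        exact ⟨rfl, hγ.injective i e⟩
      · exact ((hγ.eq_or_eq i j hij s t e).elim hp hq).elim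
    · rw [e] at hp hq
      exact ((hγδ i s j t e).elim hp hq).elim
    · exact ((hγδ j t i s e.symm).elim hp hq).elim
    · by_cases hij : i = j
      · subst hij
        exact ⟨rfl, hδ.injective i e⟩
      · have h1 : δ i s = δ i 0 := hδ.eq_of_eq i j hij s t e
        have h2 : δ i s = p ∨ δ i s = q := h1 ▸ hδ.zero i
        exact (h2.elim hp hq).elim
  have hk : ∀ j, k j = .newRay ↔ j = Sum.inr (Fin.last r) := by
    rintro (i | j)
    · simp [k]
    · by_cases h1 : j = Fin.last r
      · simp [k, h1]
      · by_cases h2 : δ j 0 = p <;> simp [k, h1, h2]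
  have hM : ArcModel k α (⟨p, by rw [hP]; exact Or.inl hpΘ⟩ : P)
      ⟨q, by rw [hP]; exact Or.inl hqΘ⟩ :=
    { surj := by
        rintro ⟨x, hx⟩
        rcases hP.subset hx with hx' | hx'
        · obtain ⟨i, t, rfl⟩ := mem_iUnion.1 (hγ.iUnion_eq.symm.subset hx')
          exact ⟨Sum.inl i, t, rfl⟩
        · obtain ⟨j, t, rfl⟩ := mem_iUnion.1 hx'
          exact ⟨Sum.inr j, t, rfl⟩
      eq_p_iff := fun i t => Subtype.ext_iff.trans (hkp i t)
      eq_q_iff := fun i t => Subtype.ext_iff.trans (hkq i t)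
      inj := fun i s j t e hp hq => hinj i s j t (congrArg Subtype.val e)
        (fun h => hp (Subtype.ext h)) (fun h => hq (Subtype.ext h))
      newRay_unique := fun i j hi hj => ((hk i).1 hi).trans ((hk j).1 hj).symm }
  have hsub : P' ⊆ P := by
    rw [hP, hP']
    exact union_subset_union_right _ (iUnion_subset fun j => subset_iUnion (fun j => range (δ j)) _)
  refine hM.isFreeExtension (i := inclusion hsub) (IsEmbedding.inclusion hsub) ?_
    (j₀ := Sum.inl i₀) (j₁ := Sum.inl ⟨1, hm⟩) (n := Sum.inr (Fin.last r)) rfl rfl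
    (by simp [i₀]) ((hk _).2 rfl) hc
  rintro ⟨x, hx⟩
  rw [range_inclusion, mem_ofPred_eq, hP']
  constructor
  · rintro (h | h)
    · obtain ⟨i, t, rfl⟩ := mem_iUnion.1 (hγ.iUnion_eq.symm.subset h)
      exact ⟨Sum.inl i, t, by simp [hk], rfl⟩
    · obtain ⟨j, t, rfl⟩ := mem_iUnion.1 h
      exact ⟨Sum.inr j.castSucc, t, by simp [hk, Fin.castSucc_ne_last], rfl⟩
  · rintro ⟨i | j, t, hj, e⟩
    · exact Or.inl (congrArg Subtype.val e ▸ hγ.mem i t)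
    · rw [Ne, hk, Sum.inr.injEq] at hj
      obtain ⟨l, rfl⟩ := Fin.exists_castSucc_eq.2 hj
      exact Or.inr (mem_iUnion.2 ⟨l, t, congrArg Subtype.val e⟩)

theorem IsTheta.isFreeExtension (hγ : IsTheta γ p q Θ) (hpq : p ≠ q) (hm : 2 ≤ m) :
    ∀ {r : ℕ} {δ : Fin r → C(I, E)}, IsRays δ p q Θ → ∀ {P : Set E},
      P = Θ ∪ ⋃ j, range (δ j) → PathConnectedSpace (UConf 3 P) ∧
        ∃ d : ℕ, r ≤ d ∧ IsFreeExtension (UConf 3 P) (UConf 3 Θ) (Fin d) := by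
  have hΘ : PathConnectedSpace (UConf 3 Θ) := hγ.pathConnectedSpace_uconf ⟨0, by omega⟩ 3
  intro r
  induction r with
  | zero =>
    intro δ _ P hP
    obtain rfl : P = Θ := by simpa using hP
    exact ⟨hΘ, 0, le_rfl, isFreeExtension_of_homotopyEquiv (ContinuousMap.HomotopyEquiv.refl _)⟩
  | succ r ih =>
    intro δ hδ P hP
    obtain ⟨hc, d, hrd, hd⟩ := ih (δ := fun j => δ j.castSucc)
      ⟨fun j => hδ.injective _, fun j => hδ.zero _, fun j => hδ.eq_of_mem _,
        fun j l hjl => hδ.eq_of_eq _ _ ((Fin.castSucc_injective r).ne hjl)⟩ rfl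
    have key : PathConnectedSpace (UConf 3 P) ∧ ∃ d : ℕ, 1 ≤ d ∧ IsFreeExtension (UConf 3 P)
        (UConf 3 (Θ ∪ ⋃ j : Fin r, range (δ j.castSucc) : Set E)) (Fin d) := by
      rcases hδ.zero (Fin.last r) with hl | hl
      · exact hδ.isFreeExtension_of_last_eq hγ hpq hm hl hP rfl hc
      · exact hδ.symm.isFreeExtension_of_last_eq hγ.symm hpq.symm hm hl hP rfl hc
    obtain ⟨hPc, d', hd', hext⟩ := key
    exact ⟨hPc, d + d', by omega, (hext.trans hd).congr finSumFinEquiv⟩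

end Pulsar

end Proof

/-- If `P ⊆ ℝ²` is a pulsar graph realization obtained from a realization `Θ` of the
generalized theta graph `Θ_m` (`m ≥ 2`) by attaching `r ≥ 1` rays at the endpoints
`p, q`, then `π₁(UConf₃(P))` is the free product of `π₁(UConf₃(Θ))` with a nontrivial
free group of finite rank. -/
theorem pulsar_braid_group_free_product
    (m : ℕ) (hm : 2 ≤ m) (r : ℕ) (hr : 1 ≤ r)
    (p q : ℝ × ℝ) (hpq : p ≠ q)
    (γ : Fin m → C(unitInterval, ℝ × ℝ))
    (hγinj : ∀ i, Function.Injective (γ i))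
    (hγ0 : ∀ i, γ i 0 = p) (hγ1 : ∀ i, γ i 1 = q)
    (hγint : ∀ i j, i ≠ j → Set.range (γ i) ∩ Set.range (γ j) = {p, q})
    (Θ : Set (ℝ × ℝ)) (hΘ : Θ = ⋃ i, Set.range (γ i))
    (δ : Fin r → C(unitInterval, ℝ × ℝ))
    (hδinj : ∀ j, Function.Injective (δ j))
    (hδ0 : ∀ j, δ j 0 = p ∨ δ j 0 = q)
    (hδΘ : ∀ j, Set.range (δ j) ∩ Θ = {δ j 0})
    (hδδ : ∀ j l, j ≠ l →
      Set.range (δ j) ∩ Set.range (δ l) ⊆ ({δ j 0} : Set (ℝ × ℝ)) ∩ {δ l 0})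
    (P : Set (ℝ × ℝ)) (hP : P = Θ ∪ ⋃ j, Set.range (δ j)) :
    ∃ n : ℕ, 1 ≤ n ∧ ∀ (x : UConf 3 ↥P) (y : UConf 3 ↥Θ),
      Nonempty (FundamentalGroup (UConf 3 ↥P) x ≃*
        Monoid.Coprod (FundamentalGroup (UConf 3 ↥Θ) y) (FreeGroup (Fin n))) := by
  have hθ : IsTheta γ p q Θ := ⟨hγinj, hγ0, hγ1,
    fun i j hij s t e => (hγint i j hij).subset ⟨⟨s, rfl⟩, ⟨t, e.symm⟩⟩, hΘ.symm⟩
  have hrays : IsRays δ p q Θ := ⟨hδinj, hδ0, fun j t ht => (hδΘ j).subset ⟨⟨t, rfl⟩, ht⟩,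
    fun j l hjl s t e => (hδδ j l hjl ⟨⟨s, rfl⟩, ⟨t, e.symm⟩⟩).1⟩
  obtain ⟨-, n, hn, hext⟩ := hθ.isFreeExtension hpq hm hrays hP
  exact ⟨n, hr.trans hn, hext⟩
end

section
/- Let C ⊆ ℝ² be the unit circle. Then for every basepoint x of UConf_3(C), the fundamental group π₁(UConf_3(C), x) is isomorphic to ℤ. (This is the base case of the proof that 3-strand braid groups of sun graphs are free: the 3-strand braid group of a cycle is ℤ.) -/
/-- The unit circle in `ℝ²`. -/
def unitCircle : Set (ℝ × ℝ) := {x : ℝ × ℝ | x.1 ^ 2 + x.2 ^ 2 = 1}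

open Topology Set

/-- Being related by a permutation of the coordinates is an equivalence relation. -/
theorem permRel_equivalence (n : ℕ) (X : Type*) : Equivalence (permRel n X) where
  refl f := ⟨1, rfl⟩
  symm := by
    rintro f g ⟨σ, h⟩
    exact ⟨σ⁻¹, by rw [← h]; ext i; simp⟩
  trans := by
    rintro f g k ⟨σ, h⟩ ⟨τ, h'⟩
    exact ⟨σ * τ, by rw [← h', ← h]; rfl⟩

/-- The projection from ordered to unordered configurations. -/
def UConf.mk {n : ℕ} {X : Type*} [TopologicalSpace X]
    (f : {f : Fin n → X // Function.Injective f}) : UConf n X :=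
  Quot.mk _ f

theorem UConf.mk_eq_mk_iff {n : ℕ} {X : Type*} [TopologicalSpace X]
    {f g : {f : Fin n → X // Function.Injective f}} :
    UConf.mk f = UConf.mk g ↔ permRel n X f g :=
  (permRel_equivalence n X).quot_mk_eq_iff f g

theorem UConf.isOpenQuotientMap_mk (n : ℕ) (X : Type*) [TopologicalSpace X] :
    IsOpenQuotientMap (UConf.mk : {f : Fin n → X // Function.Injective f} → UConf n X) := by
  have hq : IsQuotientMap (UConf.mk : {f : Fin n → X // Function.Injective f} → UConf n X) :=
    isQuotientMap_quot_mk
  refine .of_isOpenMap_isQuotientMap (fun U hU ↦ ?_) hq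
  let act (σ : Equiv.Perm (Fin n)) (f : {f : Fin n → X // Function.Injective f}) :
      {f : Fin n → X // Function.Injective f} := ⟨f.1 ∘ σ, f.2.comp σ.injective⟩
  have hact (σ) : Continuous (act σ) := by
    refine Continuous.subtype_mk (continuous_pi fun i ↦ ?_) _
    exact (continuous_apply (σ i)).comp continuous_subtype_val
  have key : UConf.mk ⁻¹' (UConf.mk '' U) = ⋃ σ, act σ ⁻¹' U := by
    ext f
    simp only [mem_preimage, mem_image, mem_iUnion, eq_comm (b := UConf.mk f),
      UConf.mk_eq_mk_iff]
    constructor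
    · rintro ⟨g, hg, σ, h⟩
      have : act σ f = g := Subtype.ext h
      exact ⟨σ, this ▸ hg⟩
    · rintro ⟨σ, hσ⟩
      exact ⟨_, hσ, σ, rfl⟩
  rw [← hq.isOpen_preimage, key]
  exact isOpen_iUnion fun σ ↦ hU.preimage (hact σ)

/-- Strictly increasing bi-infinite sequences of reals such that moving `n` steps along the
sequence adds `T`. -/
def periodicSeq (n : ℕ) (T : ℝ) : Set (ℤ → ℝ) :=
  {F | StrictMono F ∧ ∀ m, F (m + n) = F m + T}

namespace periodicSeq

variable {n : ℕ} {T : ℝ}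

theorem convex : Convex ℝ (periodicSeq n T) := by
  rintro F ⟨hF, hF'⟩ G ⟨hG, hG'⟩ a b ha hb hab
  refine ⟨fun i j hij ↦ ?_, fun m ↦ ?_⟩
  · have h₁ := hF hij
    have h₂ := hG hij
    simp only [Pi.add_apply, Pi.smul_apply, smul_eq_mul]
    rcases ha.eq_or_lt with rfl | ha
    · obtain rfl : b = 1 := by linarith
      simpa using h₂
    · nlinarith [mul_lt_mul_of_pos_left h₁ ha, mul_le_mul_of_nonneg_left h₂.le hb]
  · simp only [Pi.add_apply, Pi.smul_apply, smul_eq_mul, hF', hG']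
    linear_combination T * hab

theorem nonempty [NeZero n] (hT : 0 < T) : (periodicSeq n T).Nonempty := by
  have hn : (0 : ℝ) < n := by exact_mod_cast Nat.pos_of_neZero n
  refine ⟨fun m ↦ m * (T / n), fun i j hij ↦ ?_, fun m ↦ ?_⟩
  · have : (i : ℝ) < j := by exact_mod_cast hij
    exact mul_lt_mul_of_pos_right this (by positivity)
  · push_cast
    field_simp

/-- Integers act by translating the indices. -/
instance : MulAction (Multiplicative ℤ) (periodicSeq n T) where
  smul k F := ⟨fun m ↦ F.1 (m + k.toAdd), fun _ _ h ↦ F.2.1 (by gcongr), fun m ↦ by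
    rw [← F.2.2, add_right_comm]⟩
  one_smul F := Subtype.ext <| funext fun m ↦ congrArg F.1 (add_zero m)
  mul_smul j k F := Subtype.ext <| funext fun m ↦ congrArg F.1 <| by
    change m + (j.toAdd + k.toAdd) = m + j.toAdd + k.toAdd
    ring

@[simp] theorem smul_apply (k : Multiplicative ℤ) (F : periodicSeq n T) (m : ℤ) :
    (k • F).1 m = F.1 (m + k.toAdd) := rfl

instance : ContinuousConstSMul (Multiplicative ℤ) (periodicSeq n T) where
  continuous_const_smul k := by
    refine Continuous.subtype_mk (continuous_pi fun m ↦ ?_) _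
    exact (continuous_apply (m + k.toAdd)).comp continuous_subtype_val

/-- Near any sequence, the term of index `0` stays separated from all other terms. -/
theorem exists_nhds_disjoint (F : periodicSeq n T) : ∃ U ∈ 𝓝 F, ∀ k : Multiplicative ℤ,
    ((k • ·) '' U ∩ U).Nonempty → k = 1 := by
  have h₀ : F.1 (-1) < F.1 0 := F.2.1 (by norm_num)
  have h₁ : F.1 0 < F.1 1 := F.2.1 (by norm_num)
  obtain ⟨a, ha, ha'⟩ := exists_between h₀
  obtain ⟨b, hb, hb'⟩ := exists_between h₁
  have hc (m : ℤ) : Continuous fun G : periodicSeq n T ↦ G.1 m :=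
    (continuous_apply m).comp continuous_subtype_val
  refine ⟨{G | (G.1 (-1) < a ∧ a < G.1 0) ∧ G.1 0 < b ∧ b < G.1 1}, IsOpen.mem_nhds ?_
    ⟨⟨ha, ha'⟩, hb, hb'⟩, ?_⟩
  · exact ((isOpen_lt (hc _) continuous_const).inter (isOpen_lt continuous_const (hc _))).inter
      ((isOpen_lt (hc _) continuous_const).inter (isOpen_lt continuous_const (hc _)))
  · rintro k ⟨_, ⟨G, ⟨⟨hG₁, _⟩, _, hG₄⟩, rfl⟩, ⟨_, hG₂⟩, hG₃, _⟩
    simp only [smul_apply, zero_add] at hG₂ hG₃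
    have h₁ := G.2.1.lt_iff_lt.1 (hG₁.trans hG₂)
    have h₂ := G.2.1.lt_iff_lt.1 (hG₃.trans hG₄)
    exact Multiplicative.toAdd.injective (by rw [toAdd_one]; lia)

theorem add_mul_period (F : periodicSeq n T) (m k : ℤ) : F.1 (m + k * n) = F.1 m + k * T := by
  induction k using Int.induction_on with
  | zero => simp
  | succ k ih =>
    have := F.2.2 (m + k * n)
    rw [show m + ((k : ℤ) + 1) * n = m + k * n + n by ring, this, ih]
    push_cast
    ring
  | pred k ih =>
    have := F.2.2 (m + (-k - 1) * n)
    rw [show m + (-(k : ℤ) - 1) * n + n = m + -k * n by ring, ih] at this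
    push_cast at this ⊢
    linarith

/-- Two sequences with the same set of values differ by a translation of the indices. -/
theorem mem_orbit_of_range_eq {F G : periodicSeq n T} (h : range F.1 = range G.1) :
    F ∈ MulAction.orbit (Multiplicative ℤ) G := by
  let φ : ℤ ≃o ℤ := ((StrictMono.orderIso F.1 F.2.1).trans (OrderIso.setCongr _ _ h)).trans
    (StrictMono.orderIso G.1 G.2.1).symm
  have hφ (m : ℤ) : G.1 (φ m) = F.1 m :=
    congrArg Subtype.val ((StrictMono.orderIso G.1 G.2.1).apply_symm_apply
      (OrderIso.setCongr _ _ h (StrictMono.orderIso F.1 F.2.1 m)))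
  have hsucc (m : ℤ) : φ (m + 1) = φ m + 1 := φ.map_succ m
  have htrans (m : ℤ) : φ m = m + φ 0 := by
    induction m using Int.induction_on with
    | zero => simp
    | succ k ih => rw [hsucc, ih]; ring
    | pred k ih =>
      have := hsucc (-k - 1)
      rw [sub_add_cancel] at this
      linarith
  refine ⟨Multiplicative.ofAdd (φ 0), Subtype.ext <| funext fun m ↦ ?_⟩
  change G.1 (m + φ 0) = F.1 m
  rw [← htrans, hφ]

/-- The terms of index `0, …, n - 1` of a sequence. -/
def restrict (F : periodicSeq n T) (i : Fin n) : ℝ := F.1 (i : ℕ)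

/-- The remainder of an integer modulo `n`. -/
def residue (n : ℕ) [NeZero n] (m : ℤ) : Fin n :=
  ⟨(m % n).toNat, by
    have := Nat.pos_of_neZero n
    have := Int.emod_lt_of_pos m (b := n) (by lia)
    lia⟩

/-- The unique sequence of period `T` with prescribed terms of index `0, …, n - 1`. -/
def extend [NeZero n] (T : ℝ) (v : Fin n → ℝ) (m : ℤ) : ℝ :=
  v (residue n m) + (m / n : ℤ) * T

theorem continuous_restrict : Continuous (restrict : periodicSeq n T → Fin n → ℝ) :=
  continuous_pi fun i ↦ (continuous_apply ((i : ℕ) : ℤ)).comp continuous_subtype_val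

theorem injective_comp_restrict {X : Type*} {c : ℝ → X}
    (hc : ∀ s t, c s = c t ↔ ∃ k : ℤ, s = t + k * T)
    (F : periodicSeq n T) : Function.Injective (c ∘ restrict F) := by
  intro i j hij
  obtain ⟨k, hk⟩ := (hc _ _).1 hij
  rw [restrict, restrict, ← add_mul_period] at hk
  have h := F.2.1.injective hk
  have h' := congrArg (· % (n : ℤ)) h
  simp only [Int.add_mul_emod_self_right] at h'
  exact Fin.ext (by exact_mod_cast (show ((i : ℕ) : ℤ) = (j : ℕ) by
    rwa [Int.emod_eq_of_lt (by positivity) (by exact_mod_cast i.2),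
      Int.emod_eq_of_lt (by positivity) (by exact_mod_cast j.2)] at h'))

variable [NeZero n]

theorem emod_nonneg (n : ℕ) [NeZero n] (m : ℤ) : 0 ≤ m % n :=
  Int.emod_nonneg _ (by exact_mod_cast NeZero.ne n)

theorem continuous_extend : Continuous (extend T : (Fin n → ℝ) → ℤ → ℝ) :=
  continuous_pi fun _ ↦ (continuous_apply _).add continuous_const

theorem extend_restrict (F : periodicSeq n T) : extend T (restrict F) = F.1 := by
  funext m
  rw [extend, restrict, residue, ← add_mul_period, Int.toNat_of_nonneg (emod_nonneg n m),
    Int.emod_add_ediv_mul]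

theorem extend_mem {v : Fin n → ℝ} (hv : StrictMono v) (hv' : ∀ i j, v i < v j + T) :
    extend T v ∈ periodicSeq n T := by
  have hT : 0 < T := by simpa using hv' 0 0
  have hn : (0 : ℤ) < n := by exact_mod_cast Nat.pos_of_neZero n
  refine ⟨fun i j hij ↦ ?_, fun m ↦ ?_⟩
  · unfold extend
    rcases (Int.ediv_le_ediv hn hij.le).eq_or_lt with h | h
    · rw [h]
      gcongr
      refine hv (Fin.mk_lt_mk.2 ?_)
      have h₁ := Int.emod_add_mul_ediv i n
      have h₂ := Int.emod_add_mul_ediv j n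
      rw [h] at h₁
      have := emod_nonneg n i
      lia
    · have h' : ((i / n : ℤ) : ℝ) + 1 ≤ (j / n : ℤ) := by exact_mod_cast h
      have := mul_le_mul_of_nonneg_right h' hT.le
      refine (add_lt_add_left (hv' _ (residue n j)) _).trans_le ?_
      rw [add_assoc]
      gcongr
      linarith
  · simp only [extend, residue, Int.add_emod_right, Int.add_ediv_of_dvd_right (dvd_refl (n : ℤ)),
      Int.ediv_self hn.ne']
    push_cast
    ring

theorem restrict_extend (v : Fin n → ℝ) (i : Fin n) : extend T v (i : ℕ) = v i := by
  have hi : ((i : ℕ) : ℤ) < n := by exact_mod_cast i.2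
  have h₀ : (0 : ℤ) ≤ (i : ℕ) := by positivity
  simp [extend, residue, Int.emod_eq_of_lt h₀ hi, Int.ediv_eq_zero_of_lt h₀ hi]

theorem range_restrict : range (restrict : periodicSeq n T → Fin n → ℝ) =
    {v | (∀ i j, i < j → v i < v j) ∧ ∀ i j, v i < v j + T} := by
  ext v
  constructor
  · rintro ⟨F, rfl⟩
    refine ⟨fun i j hij ↦ F.2.1 (by exact_mod_cast hij), fun i j ↦ ?_⟩
    rw [restrict, restrict, ← F.2.2]
    exact F.2.1 (by have := i.2; lia)
  · rintro ⟨hv, hv'⟩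
    exact ⟨⟨_, extend_mem hv hv'⟩, funext fun i ↦ restrict_extend v i⟩

theorem isOpenEmbedding_restrict :
    IsOpenEmbedding (restrict : periodicSeq n T → Fin n → ℝ) where
  toIsEmbedding := .of_comp continuous_restrict continuous_extend <| by
    convert! IsEmbedding.subtypeVal
    exact funext extend_restrict
  isOpen_range := by
    rw [range_restrict]
    simp only [Set.ofPred_and, Set.ofPred_forall]
    refine .inter (isOpen_iInter_of_finite fun i ↦ isOpen_iInter_of_finite fun j ↦
      isOpen_iInter_of_finite fun _ ↦ ?_)
      (isOpen_iInter_of_finite fun i ↦ isOpen_iInter_of_finite fun j ↦ ?_) <;>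
    exact isOpen_lt (by fun_prop) (by fun_prop)

section Projection

variable {X : Type*} {c : ℝ → X}

theorem mem_range_iff (hc : ∀ s t, c s = c t ↔ ∃ k : ℤ, s = t + k * T)
    (F : periodicSeq n T) (s : ℝ) : s ∈ range F.1 ↔ c s ∈ range (c ∘ restrict F) := by
  constructor
  · rintro ⟨m, rfl⟩
    exact ⟨residue n m, ((hc _ _).2 ⟨m / n, (congrFun (extend_restrict F) m).symm⟩).symm⟩
  · rintro ⟨i, hi⟩
    obtain ⟨k, hk⟩ := (hc _ _).1 hi.symm
    rw [restrict, ← add_mul_period] at hk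
    exact ⟨_, hk.symm⟩

/-- The ordered configuration formed by the images of the terms of index `0, …, n - 1`. -/
def toConf (hc : ∀ s t, c s = c t ↔ ∃ k : ℤ, s = t + k * T) (F : periodicSeq n T) :
    {f : Fin n → X // Function.Injective f} :=
  ⟨c ∘ restrict F, injective_comp_restrict hc F⟩

variable [TopologicalSpace X]

theorem mk_toConf_eq_iff (hc : ∀ s t, c s = c t ↔ ∃ k : ℤ, s = t + k * T)
    {F G : periodicSeq n T} : UConf.mk (toConf hc F) = UConf.mk (toConf hc G) ↔
      F ∈ MulAction.orbit (Multiplicative ℤ) G := by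
  have range_eq {F G : periodicSeq n T} (h : range F.1 = range G.1) :
      range (c ∘ restrict F) ⊆ range (c ∘ restrict G) := by
    rintro _ ⟨i, rfl⟩
    exact (mem_range_iff hc G _).1 (h ▸ mem_range_self _)
  rw [UConf.mk_eq_mk_iff]
  constructor
  · rintro ⟨σ, h⟩
    apply mem_orbit_of_range_eq
    ext s
    have h : (c ∘ restrict F) ∘ σ = c ∘ restrict G := h
    rw [mem_range_iff hc, mem_range_iff hc, ← h, σ.surjective.range_comp]
  · rintro ⟨k, rfl⟩
    have hr : range (k • G).1 = range G.1 := (Equiv.addRight k.toAdd).surjective.range_comp G.1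
    have hr' : range (toConf hc (k • G)).1 = range (toConf hc G).1 :=
      (range_eq hr).antisymm (range_eq hr.symm)
    refine ⟨((Equiv.ofInjective _ (toConf hc G).2).trans (Equiv.setCongr hr'.symm)).trans
      (Equiv.ofInjective _ (toConf hc (k • G)).2).symm, funext fun i ↦ ?_⟩
    exact Equiv.apply_ofInjective_symm (toConf hc (k • G)).2 _

theorem surjective_mk_toConf (hT : 0 < T) (hs : Function.Surjective c)
    (hc : ∀ s t, c s = c t ↔ ∃ k : ℤ, s = t + k * T) :
    Function.Surjective fun F : periodicSeq n T ↦ UConf.mk (toConf hc F) := by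
  have hlift (x : X) : ∃ t ∈ Ico 0 (0 + T), c t = x := by
    obtain ⟨t, rfl⟩ := hs x
    refine ⟨toIcoMod hT 0 t, toIcoMod_mem_Ico hT 0 t, (hc _ _).2 ⟨-toIcoDiv hT 0 t, ?_⟩⟩
    rw [toIcoMod, zsmul_eq_mul]
    push_cast
    ring
  choose θ hθ hcθ using hlift
  rintro ⟨f⟩
  let σ := Tuple.sort (θ ∘ f.1)
  have hinj : Function.Injective ((θ ∘ f.1) ∘ σ) :=
    ((Function.LeftInverse.injective hcθ).comp f.2).comp σ.injective
  have hmono : StrictMono ((θ ∘ f.1) ∘ σ) := (Tuple.monotone_sort _).strictMono_of_injective hinj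
  refine ⟨⟨_, extend_mem (T := T) hmono fun i j ↦ ?_⟩, ?_⟩
  · have h₁ := (hθ (f.1 (σ i))).2
    have h₂ := (hθ (f.1 (σ j))).1
    simp only [Function.comp_apply]
    linarith
  · refine Eq.symm (UConf.mk_eq_mk_iff.2 ⟨σ, funext fun i ↦ ?_⟩)
    change f.1 (σ i) = c (extend T ((θ ∘ f.1) ∘ σ) (i : ℕ))
    rw [restrict_extend]
    exact (hcθ _).symm

theorem isOpenQuotientMap_mk_toConf (hT : 0 < T) (hq : IsOpenQuotientMap c)
    (hc : ∀ s t, c s = c t ↔ ∃ k : ℤ, s = t + k * T) :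
    IsOpenQuotientMap fun F : periodicSeq n T ↦ UConf.mk (toConf hc F) := by
  have hmk := UConf.isOpenQuotientMap_mk n X
  have hcont : Continuous fun F : periodicSeq n T ↦ c ∘ restrict F :=
    continuous_pi fun i ↦ hq.continuous.comp ((continuous_apply i).comp continuous_restrict)
  have hopen : IsOpenMap fun F : periodicSeq n T ↦ c ∘ restrict F :=
    (IsOpenQuotientMap.piMap fun _ : Fin n ↦ hq).isOpenMap.comp isOpenEmbedding_restrict.isOpenMap
  refine ⟨surjective_mk_toConf hT hq.surjective hc,
    hmk.continuous.comp (hcont.subtype_mk _), hmk.isOpenMap.comp fun U hU ↦ ?_⟩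
  refine ⟨_, hopen U hU, ?_⟩
  ext f
  simp [toConf, Subtype.ext_iff]

/-- If `c : ℝ → X` exhibits `X` as the quotient of `ℝ` by a period `T`, then the space of periodic
sequences covers the unordered configuration space of `X`, with deck group `ℤ`. -/
theorem isQuotientCoveringMap_mk_toConf (hT : 0 < T) (hq : IsOpenQuotientMap c)
    (hc : ∀ s t, c s = c t ↔ ∃ k : ℤ, s = t + k * T) :
    IsQuotientCoveringMap (fun F : periodicSeq n T ↦ UConf.mk (toConf hc F))
      (Multiplicative ℤ) where
  toIsQuotientMap := (isOpenQuotientMap_mk_toConf hT hq hc).isQuotientMap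
  continuous_const_smul := continuous_const_smul
  apply_eq_iff_mem_orbit := mk_toConf_eq_iff hc
  disjoint := exists_nhds_disjoint

end Projection

end periodicSeq

/-- The fundamental group of the space of `n ≥ 1` unordered points on a quotient of `ℝ` by a
period `T > 0` is infinite cyclic. -/
theorem UConf.nonempty_fundamentalGroup_mulEquiv_int {n : ℕ} [NeZero n] {T : ℝ} (hT : 0 < T)
    {X : Type*} [TopologicalSpace X] {c : ℝ → X} (hq : IsOpenQuotientMap c)
    (hc : ∀ s t, c s = c t ↔ ∃ k : ℤ, s = t + k * T) (x : UConf n X) :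
    Nonempty (FundamentalGroup (UConf n X) x ≃* Multiplicative ℤ) := by
  have : ContractibleSpace (periodicSeq n T) :=
    periodicSeq.convex.contractibleSpace (periodicSeq.nonempty hT)
  have hp := periodicSeq.isQuotientCoveringMap_mk_toConf (n := n) hT hq hc
  obtain ⟨e, he⟩ := hp.surjective x
  exact ⟨(hp.fundamentalGroupEquiv ⟨e, he⟩).trans MulOpposite.opMulEquiv.symm⟩

/-- The unit circle of `ℂ` is the unit circle of `ℝ × ℝ`. -/
noncomputable def circleHomeomorphUnitCircle : Circle ≃ₜ unitCircle where
  toFun z := ⟨(z.1.re, z.1.im), by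
    have := Circle.normSq_coe z
    rw [Complex.normSq_apply] at this
    change z.1.re ^ 2 + z.1.im ^ 2 = 1
    linarith⟩
  invFun p := ⟨⟨p.1.1, p.1.2⟩, by
    have : p.1.1 ^ 2 + p.1.2 ^ 2 = 1 := p.2
    refine mem_sphere_zero_iff_norm.2 ?_
    rw [← sq_eq_sq₀ (norm_nonneg _) zero_le_one, Complex.sq_norm,
      Complex.normSq_apply]
    linarith⟩
  left_inv _ := rfl
  right_inv _ := rfl
  continuous_toFun := by
    refine Continuous.subtype_mk (.prodMk ?_ ?_) _
    · exact Complex.continuous_re.comp continuous_subtype_val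
    · exact Complex.continuous_im.comp continuous_subtype_val
  continuous_invFun := by
    refine Continuous.subtype_mk (Complex.equivRealProdCLM.symm.continuous.comp
      continuous_subtype_val) _

/-- The 3-strand braid group of a cycle is `ℤ`: for the unit circle `C ⊆ ℝ²`,
the fundamental group of `UConf₃(C)` at any basepoint is isomorphic to `ℤ`. -/
theorem circle_three_strand_braid_group_int
    (x : UConf 3 ↥unitCircle) :
    Nonempty (FundamentalGroup (UConf 3 ↥unitCircle) x ≃* Multiplicative ℤ) := by
  refine UConf.nonempty_fundamentalGroup_mulEquiv_int Real.two_pi_pos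
    (c := circleHomeomorphUnitCircle ∘ Circle.exp) ?_ (fun s t ↦ ?_) x
  · exact circleHomeomorphUnitCircle.isOpenQuotientMap.comp
      Circle.isAddQuotientCoveringMap_exp.isOpenQuotientMap
  · rw [Function.comp_apply, Function.comp_apply, EmbeddingLike.apply_eq_iff_eq,
      Circle.exp_eq_exp]
end
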